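/- arXiv:1911.00178 — 3 statements merged into one kernel-verified Lean document; each statement's English description precedes it below -/
import Mathlib

section
/- Let K ⊆ ℝⁿ be a centrally symmetric convex body and let r > 0 be such that α_K(r) ∈ (0,1), and let 0 < κ < 1/10. Then there is an absolute constant c > 0 (independent of n, K, r, κ) such that α_K(r(1−κ)) ≥ α_K(r) + c · κ · (α_K(r)(1 − α_K(r)))². -/
open MeasureTheory ProbabilityTheory

/-- The standard Gaussian measure `N(0,1)ⁿ` on `ℝⁿ`. -/
noncomputable def stdGaussian (n : ℕ) : Measure (EuclideanSpace ℝ (Fin n)) :=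
  (Measure.pi fun _ : Fin n => gaussianReal 0 1).map
    (EuclideanSpace.equiv (Fin n) ℝ).symm

/-- The uniform (rotation-invariant) probability measure on the origin-centered sphere of
radius `r` in `ℝⁿ`, obtained as the pushforward of the standard Gaussian under radial
projection onto the sphere. -/
noncomputable def sphereUniform (n : ℕ) (r : ℝ) : Measure (EuclideanSpace ℝ (Fin n)) :=
  (stdGaussian n).map (fun x => (r / ‖x‖) • x)

/-- The shell density `α_K(r)`: the fraction of the radius-`r` origin-centered sphere
lying in `K`. -/
noncomputable def shellDensity (n : ℕ) (K : Set (EuclideanSpace ℝ (Fin n))) (r : ℝ) : ℝ :=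
  (sphereUniform n r K).toReal

lemma integrable_measureReal_slice {X Y : Type*} [MeasurableSpace X] [MeasurableSpace Y]
    (P : Measure X) (Q : Measure Y) [IsProbabilityMeasure P] [IsProbabilityMeasure Q]
    {S : Set (X × Y)} (hS : MeasurableSet S) :
    Integrable (fun x => Q.real {y | (x, y) ∈ S}) P :=
  Integrable.of_bound (measurable_measure_prodMk_left hS).ennreal_toReal.aestronglyMeasurable 1
    (.of_forall fun x => by
      rw [Real.norm_of_nonneg measureReal_nonneg]; exact measureReal_le_one)

lemma integral_measureReal_slice_swap {X Y : Type*} [MeasurableSpace X] [MeasurableSpace Y]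
    (P : Measure X) (Q : Measure Y) [IsProbabilityMeasure P] [IsProbabilityMeasure Q]
    {S : Set (X × Y)} (hS : MeasurableSet S) :
    ∫ x, Q.real {y | (x, y) ∈ S} ∂P = ∫ y, P.real {x | (x, y) ∈ S} ∂Q := by
  have h1 : ∫ x, Q.real {y | (x, y) ∈ S} ∂P = (P.prod Q S).toReal := by
    rw [Measure.prod_apply hS]
    exact integral_toReal (measurable_measure_prodMk_left hS).aemeasurable
      (.of_forall fun x => measure_lt_top _ _)
  have h2 : ∫ y, P.real {x | (x, y) ∈ S} ∂Q = (P.prod Q S).toReal := by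
    rw [Measure.prod_apply_symm hS]
    exact integral_toReal (measurable_measure_prodMk_right hS).aemeasurable
      (.of_forall fun x => measure_lt_top _ _)
  rw [h1, h2]

/-- If every slice over a point of `A` has measure `c`, then some transversal slice over `A` has
measure at least `P A * c`. -/
lemma exists_le_measureReal_slice {X Y : Type*} [MeasurableSpace X] [MeasurableSpace Y]
    (P : Measure X) (Q : Measure Y) [IsProbabilityMeasure P] [IsProbabilityMeasure Q]
    {A : Set X} (hA : MeasurableSet A) {S : Set (X × Y)} (hS : MeasurableSet S) {c : ℝ}
    (hc : ∀ x ∈ A, Q.real {y | (x, y) ∈ S} = c) :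
    ∃ y, P.real A * c ≤ P.real {x | x ∈ A ∧ (x, y) ∈ S} := by
  have hS' : MeasurableSet ((Prod.fst ⁻¹' A) ∩ S : Set (X × Y)) := (measurable_fst hA).inter hS
  have hswap := integral_measureReal_slice_swap P Q hS'
  have hind : ∀ x, Q.real {y | (x, y) ∈ (Prod.fst ⁻¹' A) ∩ S} = A.indicator (fun _ => c) x := by
    intro x
    by_cases hx : x ∈ A
    · simpa [hx] using hc x hx
    · simp [hx]
  simp_rw [hind] at hswap
  rw [integral_indicator_const _ hA, smul_eq_mul] at hswap
  obtain ⟨y, hy⟩ := exists_integral_le (μ := Q) (f := fun y => P.real {x | x ∈ A ∧ (x, y) ∈ S})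
    (integrable_measureReal_slice Q P (S := Prod.swap ⁻¹' ((Prod.fst ⁻¹' A) ∩ S))
      (measurable_swap hS'))
  exact ⟨y, le_trans hswap.le hy⟩

lemma measureReal_translate_pow_le {G : Type*} [CommGroup G] [MeasurableSpace G] [MeasurableMul G]
    (μ : Measure G) [IsProbabilityMeasure μ] [μ.IsMulLeftInvariant] {A : Set G}
    (hA : MeasurableSet A) (v : G) (m : ℕ) :
    μ.real {z | z ∈ A ∧ v ^ m * z ∉ A} ≤ m * μ.real {z | z ∈ A ∧ v * z ∉ A} := by
  induction m with
  | zero => simp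
  | succ m ih =>
    have hmeas : MeasurableSet {z | z ∈ A ∧ v * z ∉ A} :=
      hA.inter (measurable_const_mul v hA).compl
    have h1 : μ.real ((fun z => v ^ m * z) ⁻¹' {z | z ∈ A ∧ v * z ∉ A}) =
        μ.real {z | z ∈ A ∧ v * z ∉ A} := by
      rw [measureReal_def, measure_preimage_mul, measureReal_def]
    have h2 : {z | z ∈ A ∧ v ^ (m + 1) * z ∉ A} ⊆
        {z | z ∈ A ∧ v ^ m * z ∉ A} ∪ (fun z => v ^ m * z) ⁻¹' {z | z ∈ A ∧ v * z ∉ A} := by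
      rintro z ⟨hz, hz'⟩
      by_cases h : v ^ m * z ∈ A
      · exact Or.inr ⟨h, by rwa [← mul_assoc, ← pow_succ']⟩
      · exact Or.inl ⟨hz, h⟩
    have h3 := (measureReal_mono (μ := μ) h2).trans (measureReal_union_le _ _)
    push_cast
    linarith

lemma exists_measureReal_translate_ge {G : Type*} [CommGroup G] [MeasurableSpace G]
    [MeasurableMul₂ G]
    (μ : Measure G) [IsProbabilityMeasure μ] [μ.IsMulLeftInvariant] {A : Set G}
    (hA : MeasurableSet A) :
    ∃ w : G, μ.real A * (1 - μ.real A) ≤ μ.real {z | z ∈ A ∧ w * z ∉ A} := by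
  refine exists_le_measureReal_slice μ μ hA (S := {p | p.2 * p.1 ∉ A})
    ((measurable_snd.mul measurable_fst hA).compl) fun x _ => ?_
  change μ.real ((fun w => w * x) ⁻¹' Aᶜ) = _
  rw [measureReal_def, measure_preimage_mul_right, ← measureReal_def, probReal_compl_eq_one_sub hA]

/-- A circle set of positive measure contains two points whose directions are well separated. -/
lemma exists_separated_of_measureReal_pos [MeasurableSpace Circle] [BorelSpace Circle]
    (μ : Measure Circle) [IsProbabilityMeasure μ] [μ.IsMulLeftInvariant] {A : Set Circle}
    (hA : MeasurableSet A) (hpos : 0 < μ.real A) :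
    ∃ p ∈ A, ∃ q ∈ A, μ.real A / 3 ≤ |((p⁻¹ * q : Circle) : ℂ).im| := by
  by_contra! hcon
  set a := μ.real A with ha
  have ha1 : a ≤ 1 := measureReal_le_one
  set m : ℕ := ⌊1 / a⌋₊ + 1 with hm
  have hm1 : 1 / a < m := by rw [hm]; push_cast; exact Nat.lt_floor_add_one _
  have hm2 : ((m : ℝ) - 1) * a ≤ 1 := by
    have : ((⌊1 / a⌋₊ : ℕ) : ℝ) ≤ 1 / a := Nat.floor_le (by positivity)
    rw [hm]; push_cast
    rw [le_div_iff₀ hpos] at this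
    linarith
  let w : ℕ → Circle := fun k => Circle.exp (k * (2 * a / 3))
  have hsin : ∀ j k : ℕ, j < k → k < m → a / 3 ≤ Real.sin ((k - j : ℝ) * (2 * a / 3)) := by
    intro j k hjk hkm
    have h1 : (1 : ℝ) ≤ k - j := by
      have : (j : ℝ) + 1 ≤ k := by exact_mod_cast hjk
      linarith
    have h2 : (k - j : ℝ) ≤ m - 1 := by
      have : (k : ℝ) + 1 ≤ m := by exact_mod_cast hkm
      have : (0 : ℝ) ≤ j := Nat.cast_nonneg j
      linarith
    have h3 : (k - j : ℝ) * (2 * a / 3) ≤ 2 / 3 := by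
      nlinarith [mul_le_mul_of_nonneg_right h2 hpos.le]
    have h4 : 2 * a / 3 ≤ (k - j : ℝ) * (2 * a / 3) := by nlinarith
    have h5 := Real.mul_le_sin (x := (k - j : ℝ) * (2 * a / 3)) (by linarith)
      (by linarith [Real.pi_gt_three])
    have h6 : 1 / 2 ≤ 2 / Real.pi := by
      rw [div_le_div_iff₀ (by norm_num) Real.pi_pos]; linarith [Real.pi_le_four]
    nlinarith
  have key : ∀ j k : ℕ, j < k → k < m → Disjoint ((fun z => w j * z) ⁻¹' A)
      ((fun z => w k * z) ⁻¹' A) := by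
    intro j k hjk hkm
    rw [Set.disjoint_left]
    intro z hj hk
    have h := hcon _ hj _ hk
    have h1 : (w j * z)⁻¹ * (w k * z) = Circle.exp ((k - j : ℝ) * (2 * a / 3)) := by
      rw [mul_inv, sub_mul, Circle.exp_sub, div_eq_mul_inv]
      simp only [w]
      rw [mul_mul_mul_comm, inv_mul_cancel z, mul_one, mul_comm]
    rw [h1, Circle.coe_exp, Complex.exp_ofReal_mul_I_im] at h
    exact absurd (hsin j k hjk hkm) (not_le.mpr (lt_of_le_of_lt (le_abs_self _) h))
  have hdisj : Pairwise (Function.onFun Disjoint fun k : Fin m => (fun z => w k * z) ⁻¹' A) := by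
    intro j k hjk
    rcases lt_or_gt_of_ne hjk with h | h
    · exact key j k h k.2
    · exact (key k j h j.2).symm
  have hsum : ∑ k : Fin m, μ.real ((fun z => w k * z) ⁻¹' A) ≤ 1 := by
    rw [← measureReal_iUnion_fintype hdisj fun k => measurable_const_mul _ hA]
    exact measureReal_le_one
  have : ∀ k : Fin m, μ.real ((fun z => w k * z) ⁻¹' A) = a := fun k => by
    rw [measureReal_def, measure_preimage_mul, ← measureReal_def]
  simp only [this, Finset.sum_const, Finset.card_univ, Fintype.card_fin, nsmul_eq_mul] at hsum
  rw [div_lt_iff₀ hpos] at hm1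
  linarith

/-- A symmetric convex planar set with two well separated unit vectors contains a disc. -/
lemma mem_of_norm_le_of_separated {L : Set ℂ} (hconv : Convex ℝ L) (hsymm : ∀ z ∈ L, -z ∈ L)
    {p q : Circle} (hp : (p : ℂ) ∈ L) (hq : (q : ℂ) ∈ L) {s : ℝ} (hs : 0 < s)
    (hpq : s ≤ |((p⁻¹ * q : Circle) : ℂ).im|) {v : ℂ} (hv : ‖v‖ ≤ s / 2) : v ∈ L := by
  have h0 : (0 : ℂ) ∈ L := by
    have := hconv hp (hsymm _ hp) (a := 1 / 2) (b := 1 / 2) (by norm_num) (by norm_num)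
      (by norm_num)
    simpa using this
  set σ := ((p⁻¹ * q : Circle) : ℂ).im with hσ
  have hσ0 : σ ≠ 0 := by intro h; rw [h] at hpq; simp at hpq; linarith
  have hσe : σ = (p : ℂ).re * (q : ℂ).im - (p : ℂ).im * (q : ℂ).re := by
    rw [hσ, Circle.coe_mul, Circle.coe_inv_eq_conj]; simp; ring
  set x := (v.re * (q : ℂ).im - v.im * (q : ℂ).re) / σ with hx
  set y := ((p : ℂ).re * v.im - (p : ℂ).im * v.re) / σ with hy
  have hvxy : v = x • (p : ℂ) + y • (q : ℂ) := by
    apply Complex.ext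
    · simp [hx, hy]; field_simp; rw [hσe]; ring
    · simp [hx, hy]; field_simp; rw [hσe]; ring
  have hbound : ∀ u : Circle, |v.re * (u : ℂ).im - v.im * (u : ℂ).re| ≤ s / 2 := by
    intro u
    have : v.re * (u : ℂ).im - v.im * (u : ℂ).re = (starRingEnd ℂ v * u).im := by simp; ring
    rw [this]
    refine (Complex.abs_im_le_norm _).trans ?_
    rwa [norm_mul, RCLike.norm_conj, Circle.norm_coe, mul_one]
  have hx1 : |x| ≤ 1 / 2 := by
    rw [hx, abs_div, div_le_iff₀ (abs_pos.mpr hσ0)]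
    linarith [hbound q]
  have hy1 : |y| ≤ 1 / 2 := by
    rw [hy, abs_div, div_le_iff₀ (abs_pos.mpr hσ0)]
    have := hbound p
    rw [abs_sub_comm, mul_comm v.im, mul_comm v.re] at this
    linarith
  have hmul : ∀ (t : ℝ) (z : ℂ), |t| ≤ 1 / 2 → z ∈ L → (2 * t) • z ∈ L := by
    intro t z ht hz
    obtain ⟨h1, h2⟩ := abs_le.mp ht
    have := hconv hz (hsymm z hz) (a := 1 / 2 + t) (b := 1 / 2 - t) (by linarith) (by linarith)
      (by ring)
    convert this using 1
    rw [smul_neg, ← sub_eq_add_neg, ← sub_smul]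
    congr 1; ring
  have := hconv (hmul x p hx1 hp) (hmul y q hy1 hq) (a := 1 / 2) (b := 1 / 2) (by norm_num)
    (by norm_num) (by norm_num)
  rw [smul_smul, smul_smul] at this
  rw [hvxy]
  convert this using 3 <;> ring

lemma Circle.norm_exp_sub_one_le (t : ℝ) : ‖(Circle.exp t : ℂ) - 1‖ ≤ |t| := by
  rw [Circle.coe_exp, mul_comm]
  exact Real.norm_exp_I_mul_ofReal_sub_one_le

/-- Planar density increment for symmetric convex sets. -/
lemma circle_density_increment [MeasurableSpace Circle] [BorelSpace Circle]
    (μ : Measure Circle) [IsProbabilityMeasure μ] [μ.IsMulLeftInvariant] {L : Set ℂ}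
    (hcl : IsClosed L) (hconv : Convex ℝ L) (hsymm : ∀ z ∈ L, -z ∈ L)
    {κ : ℝ} (hκ : 0 < κ) (hκ1 : κ < 1) :
    μ.real {z : Circle | (z : ℂ) ∈ L} + κ / 30 *
        (μ.real {z : Circle | (z : ℂ) ∈ L} * (1 - μ.real {z : Circle | (z : ℂ) ∈ L})) ^ 2 ≤
      μ.real {z : Circle | (1 - κ) • (z : ℂ) ∈ L} := by
  set A : Set Circle := {z : Circle | (z : ℂ) ∈ L} with hAdef
  set B : Set Circle := {z : Circle | (1 - κ) • (z : ℂ) ∈ L} with hBdef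
  have hA : MeasurableSet A := (hcl.preimage (f := fun z : Circle => (z : ℂ)) (by fun_prop)).measurableSet
  have hB : MeasurableSet B :=
    (hcl.preimage (f := fun z : Circle => (1 - κ) • (z : ℂ)) (by fun_prop)).measurableSet
  set a := μ.real A with ha
  rcases (measureReal_nonneg (μ := μ) (s := A)).eq_or_lt with h0 | hpos
  · rw [← ha] at h0
    rw [← h0]
    simp
  rw [← ha] at hpos
  have ha1 : a ≤ 1 := measureReal_le_one
  obtain ⟨p, hp, q, hq, hpq⟩ := exists_separated_of_measureReal_pos μ hA hpos
  have hdisc : ∀ v : ℂ, ‖v‖ ≤ a / 6 → v ∈ L := fun v hv =>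
    mem_of_norm_le_of_separated hconv hsymm hp hq (by positivity) hpq (by linarith)
  have hrot : ∀ z ∈ A, ∀ t : ℝ, |t| ≤ κ * (a / 6) → Circle.exp t * z ∈ B := by
    intro z hz t ht
    have hv : ‖((1 - κ) / κ) • (((Circle.exp t : ℂ) - 1) * z)‖ ≤ a / 6 := by
      rw [norm_smul, norm_mul, Circle.norm_coe, mul_one, Real.norm_of_nonneg
        (div_nonneg (by linarith) hκ.le), div_mul_eq_mul_div, div_le_iff₀ hκ]
      have := Circle.norm_exp_sub_one_le t
      nlinarith [norm_nonneg ((Circle.exp t : ℂ) - 1)]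
    have := hconv hz (hdisc _ hv) (a := 1 - κ) (b := κ) (by linarith) hκ.le (by ring)
    rw [smul_smul, mul_div_cancel₀ _ hκ.ne', ← smul_add] at this
    change (1 - κ) • ((Circle.exp t * z : Circle) : ℂ) ∈ L
    convert this using 2
    push_cast; ring
  have hAB : A ⊆ B := fun z hz => by
    simpa using hrot z hz 0 (by simp; positivity)
  obtain ⟨w, hw⟩ := exists_measureReal_translate_ge μ hA
  set u := κ * (a / 6) with hu
  have hu0 : 0 < u := by positivity
  set m : ℕ := ⌈Real.pi / u⌉₊ with hm
  have hm0 : 0 < m := Nat.ceil_pos.mpr (div_pos Real.pi_pos hu0)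
  have hm0' : (0 : ℝ) < m := by exact_mod_cast hm0
  have hm1 : Real.pi ≤ m * u := by
    rw [← div_le_iff₀ hu0]; exact Nat.le_ceil _
  have hm2 : m * u ≤ 5 := by
    have h1 : (m : ℝ) < Real.pi / u + 1 := Nat.ceil_lt_add_one (by positivity)
    have h2 : (Real.pi / u + 1) * u = Real.pi + u := by field_simp
    have h3 : u ≤ 1 / 6 := by rw [hu]; nlinarith
    nlinarith [Real.pi_lt_d2]
  set t := Complex.arg w / m with ht
  have htu : |t| ≤ u := by
    rw [ht, abs_div, abs_of_pos hm0', div_le_iff₀ hm0']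
    linarith [Complex.abs_arg_le_pi w]
  have hwt : w = Circle.exp t ^ m := by
    rw [← Circle.exp_nsmul, nsmul_eq_mul, ht, mul_div_cancel₀ _ hm0'.ne', Circle.exp_arg]
  have h1 := measureReal_translate_pow_le μ hA (Circle.exp t) m
  rw [← hwt] at h1
  have h2 : μ.real {z | z ∈ A ∧ Circle.exp t * z ∉ A} ≤ μ.real (B \ A) := by
    have : μ.real ((fun z => Circle.exp t * z) ⁻¹' (B \ A)) = μ.real (B \ A) := by
      rw [measureReal_def, measure_preimage_mul, measureReal_def]
    rw [← this]
    exact measureReal_mono fun z hz => ⟨hrot z hz.1 t htu, hz.2⟩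
  rw [measureReal_sdiff hAB hA] at h2
  set g := μ.real B - a with hg
  have h3 : a * (1 - a) ≤ m * g := hw.trans (h1.trans (by gcongr))
  have hg0 : 0 ≤ g := by have := measureReal_mono (μ := μ) hAB; rw [hg]; linarith
  have h4 : u * (a * (1 - a)) ≤ 5 * g := by nlinarith
  have h5 : κ * (a * (1 - a)) ^ 2 ≤ κ * (a ^ 2 * (1 - a)) := by
    have : (a * (1 - a)) ^ 2 ≤ a ^ 2 * (1 - a) := by
      have : 0 ≤ a ^ 2 * (1 - a) * a := by
        have : 0 ≤ 1 - a := by linarith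
        positivity
      nlinarith
    gcongr
  have h6 : u * (a * (1 - a)) = κ * (a ^ 2 * (1 - a)) / 6 := by rw [hu]; ring
  linarith

/-- A random linear isometry whose law is invariant under right multiplication, as provided by the
Haar measure of the orthogonal group. -/
lemma exists_random_isometry (n : ℕ) :
    ∃ (Ω : Type) (_ : MeasurableSpace Ω) (P : Measure Ω) (_ : IsProbabilityMeasure P)
      (U : Ω → (EuclideanSpace ℝ (Fin n) ≃ₗᵢ[ℝ] EuclideanSpace ℝ (Fin n))),
      (∀ x, Measurable fun ω => U ω x) ∧
      ∀ (T : EuclideanSpace ℝ (Fin n) ≃ₗᵢ[ℝ] EuclideanSpace ℝ (Fin n))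
        (x y : EuclideanSpace ℝ (Fin n)),
        P.map (fun ω => (U ω (T x), U ω (T y))) = P.map (fun ω => (U ω x, U ω y)) := by
  let E := EuclideanSpace ℝ (Fin n)
  have : ContinuousStar (E →L[ℝ] E) := ⟨ContinuousLinearMap.adjoint.continuous⟩
  have : ContinuousMul (E →L[ℝ] E) := inferInstance
  let G := unitary (E →L[ℝ] E)
  have : IsTopologicalGroup G := inferInstance
  have : CompactSpace G := by
    refine isCompact_iff_compactSpace.mp (Metric.isCompact_of_isClosed_isBounded
      isClosed_unitary ?_)
    refine (Metric.isBounded_closedBall (x := (0 : E →L[ℝ] E)) (r := 1)).subset fun u hu => ?_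
    rw [mem_closedBall_zero_iff]
    exact u.opNorm_le_bound zero_le_one fun x => by
      rw [u.norm_map_of_mem_unitary hu, one_mul]
  let : MeasurableSpace G := borel G
  have : BorelSpace G := ⟨rfl⟩
  let P : Measure G := Measure.haarMeasure ⊤
  have : IsProbabilityMeasure P := ⟨by
    have := Measure.haarMeasure_self (K₀ := (⊤ : TopologicalSpace.PositiveCompacts G))
    simpa using this⟩
  have hmeas : ∀ x : E, Measurable fun u : G => Unitary.linearIsometryEquiv u⁻¹ x := fun x => by
    have h1 : Continuous fun u : G => ((u⁻¹ : G) : E →L[ℝ] E) x :=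
      (continuous_subtype_val.comp continuous_inv).clm_apply continuous_const
    exact h1.measurable
  refine ⟨G, inferInstance, P, inferInstance, fun u => Unitary.linearIsometryEquiv u⁻¹, hmeas,
    fun T x y => ?_⟩
  let t : G := Unitary.linearIsometryEquiv.symm T
  have hT : ∀ (u : G) (z : E), Unitary.linearIsometryEquiv u⁻¹ (T z) =
      Unitary.linearIsometryEquiv (t⁻¹ * u)⁻¹ z := by
    intro u z
    have : T = Unitary.linearIsometryEquiv t := by simp [t]
    rw [mul_inv_rev, inv_inv, map_mul, this]
    rfl
  simp_rw [hT]
  have h := (measurePreserving_mul_left P t⁻¹).map_eq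
  conv_rhs => rw [← h]
  rw [Measure.map_map ((hmeas x).prodMk (hmeas y)) (measurable_const_mul _)]
  rfl

lemma stdGaussian_eq (n : ℕ) :
    _root_.stdGaussian n = ProbabilityTheory.stdGaussian (EuclideanSpace ℝ (Fin n)) :=
  map_pi_eq_stdGaussian

instance isProbabilityMeasure_stdGaussian' (n : ℕ) :
    IsProbabilityMeasure (_root_.stdGaussian n) := by
  rw [stdGaussian_eq]; infer_instance

lemma measurable_radial (n : ℕ) (r : ℝ) :
    Measurable fun x : EuclideanSpace ℝ (Fin n) => (r / ‖x‖) • x := by fun_prop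

instance isProbabilityMeasure_sphereUniform (n : ℕ) (r : ℝ) :
    IsProbabilityMeasure (sphereUniform n r) :=
  Measure.isProbabilityMeasure_map (measurable_radial n r).aemeasurable

lemma stdGaussian_map_isometry (n : ℕ)
    (T : EuclideanSpace ℝ (Fin n) ≃ₗᵢ[ℝ] EuclideanSpace ℝ (Fin n)) :
    (_root_.stdGaussian n).map T = _root_.stdGaussian n := by
  rw [stdGaussian_eq]; exact stdGaussian_map T

lemma sphereUniform_map_isometry (n : ℕ) (r : ℝ)
    (T : EuclideanSpace ℝ (Fin n) ≃ₗᵢ[ℝ] EuclideanSpace ℝ (Fin n)) :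
    (sphereUniform n r).map T = sphereUniform n r := by
  have hT : Measurable T := T.continuous.measurable
  conv_rhs => rw [sphereUniform, ← stdGaussian_map_isometry n T]
  rw [sphereUniform, Measure.map_map hT (measurable_radial n r),
    Measure.map_map (measurable_radial n r) hT]
  congr 1
  ext x : 1
  simp

/-- Proper subspaces are null for the standard Gaussian. -/
lemma stdGaussian_submodule (n : ℕ) (W : Submodule ℝ (EuclideanSpace ℝ (Fin n))) (hW : W ≠ ⊤) :
    _root_.stdGaussian n W = 0 := by
  have hW' : Wᗮ ≠ ⊥ := fun h => hW (W.orthogonal_eq_bot_iff.mp h)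
  obtain ⟨v, hv, hv0⟩ := Submodule.exists_mem_ne_zero_of_ne_bot hW'
  rw [stdGaussian_eq]
  let L : StrongDual ℝ (EuclideanSpace ℝ (Fin n)) := innerSL ℝ v
  have hL : (ProbabilityTheory.stdGaussian (EuclideanSpace ℝ (Fin n))).map L
      = gaussianReal 0 (‖L‖ ^ 2).toNNReal := by
    rw [IsGaussian.map_eq_gaussianReal, integral_strongDual_stdGaussian, variance_dual_stdGaussian]
  have hne : (‖L‖ ^ 2).toNNReal ≠ 0 := by
    have : 0 < ‖L‖ := by
      rw [innerSL_apply_norm]; exact norm_pos_iff.mpr hv0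
    rw [ne_eq, Real.toNNReal_eq_zero, not_le]
    positivity
  have := nullSingletonClass_gaussianReal (μ := 0) hne
  refine measure_mono_null (t := L ⁻¹' {0}) (fun x hx => ?_) ?_
  · simpa [L] using (Submodule.mem_orthogonal' W v).mp hv x hx
  · rw [← Measure.map_apply L.measurable (measurableSet_singleton 0), hL, measure_singleton]

lemma shellDensity_eq_stdGaussian (n : ℕ) {S : Set (EuclideanSpace ℝ (Fin n))}
    (hS : MeasurableSet S) (r : ℝ) :
    shellDensity n S r = (_root_.stdGaussian n).real {x | (r / ‖x‖) • x ∈ S} := by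
  rw [shellDensity, sphereUniform, Measure.map_apply (measurable_radial n r) hS]
  rfl

lemma shellDensity_mono (n : ℕ) {S S' : Set (EuclideanSpace ℝ (Fin n))} (h : S ⊆ S') (r : ℝ) :
    shellDensity n S r ≤ shellDensity n S' r :=
  measureReal_mono (μ := sphereUniform n r) h

lemma shellDensity_preimage_isometry (n : ℕ) {S : Set (EuclideanSpace ℝ (Fin n))}
    (hS : MeasurableSet S) (r : ℝ)
    (T : EuclideanSpace ℝ (Fin n) ≃ₗᵢ[ℝ] EuclideanSpace ℝ (Fin n)) :
    shellDensity n (T ⁻¹' S) r = shellDensity n S r := by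
  conv_rhs => rw [shellDensity, ← sphereUniform_map_isometry n r T,
    Measure.map_apply T.continuous.measurable hS]
  rfl

/-- A right-invariant random isometry sends every unit vector to a uniform point of the sphere. -/
lemma measureReal_random_isometry {n : ℕ} {Ω : Type} [MeasurableSpace Ω] (P : Measure Ω)
    [IsProbabilityMeasure P] (U : Ω → (EuclideanSpace ℝ (Fin n) ≃ₗᵢ[ℝ] EuclideanSpace ℝ (Fin n)))
    (hU : Measurable (Function.uncurry fun ω x => U ω x))
    (hinv : ∀ (T : EuclideanSpace ℝ (Fin n) ≃ₗᵢ[ℝ] EuclideanSpace ℝ (Fin n))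
      (x y : EuclideanSpace ℝ (Fin n)),
      P.map (fun ω => (U ω (T x), U ω (T y))) = P.map (fun ω => (U ω x, U ω y)))
    {S : Set (EuclideanSpace ℝ (Fin n))} (hS : MeasurableSet S) (r : ℝ)
    {e : EuclideanSpace ℝ (Fin n)} (he : ‖e‖ = 1) :
    P.real {ω | r • U ω e ∈ S} = shellDensity n S r := by
  set γ := _root_.stdGaussian n with hγ
  have hUx : ∀ x, Measurable fun ω => U ω x := fun x => hU.comp (measurable_id.prodMk measurable_const)
  have hunit : ∀ x : EuclideanSpace ℝ (Fin n), ‖x‖ = 1 →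
      P.real {ω | r • U ω x ∈ S} = P.real {ω | r • U ω e ∈ S} := by
    intro x hx
    obtain ⟨T, hT⟩ : ∃ T : EuclideanSpace ℝ (Fin n) ≃ₗᵢ[ℝ] EuclideanSpace ℝ (Fin n), T e = x :=
      ⟨(ℝ ∙ (e - x))ᗮ.reflection, Submodule.reflection_sub (by rw [he, hx])⟩
    have h := congrArg (fun m => m.real {p | r • p.1 ∈ S}) (hinv T e e)
    have hm : MeasurableSet {p : EuclideanSpace ℝ (Fin n) × EuclideanSpace ℝ (Fin n) |
        r • p.1 ∈ S} := (measurable_fst.const_smul r) hS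
    rw [map_measureReal_apply ((hUx _).prodMk (hUx _)) hm,
      map_measureReal_apply ((hUx _).prodMk (hUx _)) hm, hT] at h
    exact h
  have hmeas : MeasurableSet {p : EuclideanSpace ℝ (Fin n) × Ω |
      r • U p.2 (‖p.1‖⁻¹ • p.1) ∈ S} := by
    have h1 : Measurable fun p : EuclideanSpace ℝ (Fin n) × Ω => (p.2, ‖p.1‖⁻¹ • p.1) := by fun_prop
    exact ((hU.comp h1).const_smul r) hS
  have hswap := integral_measureReal_slice_swap γ P hmeas
  have hnull : γ {0} = 0 := by
    have := stdGaussian_submodule n ⊥ (fun h => by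
      have : e ∈ (⊥ : Submodule ℝ (EuclideanSpace ℝ (Fin n))) := h ▸ Submodule.mem_top
      rw [Submodule.mem_bot] at this
      simp [this] at he)
    simpa using this
  have hleft : ∫ x, P.real {ω | (x, ω) ∈ {p : EuclideanSpace ℝ (Fin n) × Ω |
      r • U p.2 (‖p.1‖⁻¹ • p.1) ∈ S}} ∂γ = P.real {ω | r • U ω e ∈ S} := by
    have : ∀ᵐ x ∂γ, P.real {ω | (x, ω) ∈ {p : EuclideanSpace ℝ (Fin n) × Ω |
        r • U p.2 (‖p.1‖⁻¹ • p.1) ∈ S}} = P.real {ω | r • U ω e ∈ S} := by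
      filter_upwards [measure_eq_zero_iff_ae_notMem.mp hnull] with x hx
      refine hunit _ ?_
      have : ‖x‖ ≠ 0 := norm_ne_zero_iff.mpr hx
      rw [norm_smul, norm_inv, norm_norm, inv_mul_cancel₀ this]
    rw [integral_congr_ae this]
    simp
  have hright : ∀ ω, γ.real {x | (x, ω) ∈ {p : EuclideanSpace ℝ (Fin n) × Ω |
      r • U p.2 (‖p.1‖⁻¹ • p.1) ∈ S}} = shellDensity n S r := by
    intro ω
    rw [← shellDensity_preimage_isometry n hS r (U ω),
      shellDensity_eq_stdGaussian n ((U ω).continuous.measurable hS)]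
    congr 1
    ext x
    simp [smul_smul, div_eq_mul_inv]
  rw [hleft] at hswap
  simp_rw [hright] at hswap
  rw [hswap]
  simp

/-- Two unit vectors that are not parallel lie on the unit circle of an isometric copy of `ℂ`. -/
lemma exists_complex_isometry {n : ℕ} {e w : EuclideanSpace ℝ (Fin n)} (he : ‖e‖ = 1)
    (hw : ‖w‖ = 1) (h1 : w ≠ e) (h2 : w ≠ -e) :
    ∃ (J : ℂ →ₗᵢ[ℝ] EuclideanSpace ℝ (Fin n)) (ζ : Circle), J 1 = e ∧ J ζ = w := by
  set c := inner ℝ e w with hc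
  set d := w - c • e with hd
  have hed : inner ℝ e d = 0 := by
    rw [hd, inner_sub_right, inner_smul_right, real_inner_self_eq_norm_sq, he]; simp [hc]
  have hwd : w = c • e + d := by rw [hd]; abel
  have hnorm : c ^ 2 + ‖d‖ ^ 2 = 1 := by
    have := norm_add_sq_eq_norm_sq_add_norm_sq_of_inner_eq_zero (c • e) d
      (by rw [real_inner_smul_left, hed, mul_zero])
    rw [← hwd, hw, norm_smul, he, mul_one, Real.norm_eq_abs] at this
    nlinarith [sq_abs c]
  have hd0 : ‖d‖ ≠ 0 := by
    intro h
    have hc1 : c = 1 ∨ c = -1 := by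
      rw [h] at hnorm
      exact mul_self_eq_one_iff.mp (by linarith)
    rw [norm_eq_zero] at h
    rw [h, add_zero] at hwd
    rcases hc1 with hc1 | hc1
    · exact h1 (by rw [hwd, hc1, one_smul])
    · exact h2 (by rw [hwd, hc1, neg_one_smul])
  set f := ‖d‖⁻¹ • d with hf
  have hf1 : ‖f‖ = 1 := by rw [hf, norm_smul, norm_inv, norm_norm, inv_mul_cancel₀ hd0]
  have hef : inner ℝ e f = 0 := by rw [hf, real_inner_smul_right, hed, mul_zero]
  let J₀ : ℂ →ₗ[ℝ] EuclideanSpace ℝ (Fin n) :=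
    Complex.reLm.smulRight e + Complex.imLm.smulRight f
  have hJ : ∀ z : ℂ, J₀ z = z.re • e + z.im • f := fun z => rfl
  let J : ℂ →ₗᵢ[ℝ] EuclideanSpace ℝ (Fin n) := ⟨J₀, fun z => by
    have := norm_add_sq_eq_norm_sq_add_norm_sq_of_inner_eq_zero (z.re • e) (z.im • f)
      (by rw [real_inner_smul_left, real_inner_smul_right, hef, mul_zero, mul_zero])
    rw [← sq_eq_sq₀ (norm_nonneg _) (norm_nonneg _), hJ, sq, this, norm_smul, norm_smul, he, hf1,
      ← Complex.normSq_eq_norm_sq, Complex.normSq_apply]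
    simp⟩
  have hζ : ‖(⟨c, ‖d‖⟩ : ℂ)‖ = 1 := by
    rw [← sq_eq_sq₀ (norm_nonneg _) zero_le_one, ← Complex.normSq_eq_norm_sq, Complex.normSq_apply]
    simp only
    linarith
  refine ⟨J, ⟨⟨c, ‖d‖⟩, mem_sphere_zero_iff_norm.mpr hζ⟩, ?_, ?_⟩
  · change J₀ 1 = e
    rw [hJ]; simp
  · change J₀ ⟨c, ‖d‖⟩ = w
    rw [hJ, hf, smul_smul, mul_inv_cancel₀ hd0, one_smul, ← hwd]

/-- Rotations of an isometrically embedded complex line extend to isometries of the whole space. -/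
lemma exists_isometry_extending_rotation {n : ℕ} (J : ℂ →ₗᵢ[ℝ] EuclideanSpace ℝ (Fin n))
    (z : Circle) :
    ∃ T : EuclideanSpace ℝ (Fin n) ≃ₗᵢ[ℝ] EuclideanSpace ℝ (Fin n), ∀ v : ℂ, T (J v) = J (z * v) := by
  let T₀ : LinearMap.range J.toLinearMap →ₗᵢ[ℝ] EuclideanSpace ℝ (Fin n) :=
    (J.comp (rotation z).toLinearIsometry).comp J.equivRange.symm.toLinearIsometry
  refine ⟨T₀.extend.toLinearIsometryEquiv rfl, fun v => ?_⟩
  have h := T₀.extend_apply (J.equivRange v)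
  have h2 : T₀ (J.equivRange v) = J (z * v) := by
    change J (rotation z (J.equivRange.symm (J.equivRange v))) = _
    rw [LinearIsometryEquiv.symm_apply_apply, rotation_apply]
  rw [h2] at h
  exact h

/-- Some rotation angle in some plane moves a random point of `C` out of `C` with the probability
with which an independent random point lies outside `C`. -/
lemma exists_plane_escaping {n : ℕ} {Ω : Type} [MeasurableSpace Ω] (P : Measure Ω)
    [IsProbabilityMeasure P] (U : Ω → (EuclideanSpace ℝ (Fin n) ≃ₗᵢ[ℝ] EuclideanSpace ℝ (Fin n)))
    (hU : Measurable (Function.uncurry fun ω x => U ω x))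
    (hinv : ∀ (T : EuclideanSpace ℝ (Fin n) ≃ₗᵢ[ℝ] EuclideanSpace ℝ (Fin n))
      (x y : EuclideanSpace ℝ (Fin n)),
      P.map (fun ω => (U ω (T x), U ω (T y))) = P.map (fun ω => (U ω x, U ω y)))
    {C : Set (EuclideanSpace ℝ (Fin n))} (hC : MeasurableSet C) (hsymm : ∀ x ∈ C, -x ∈ C) {r : ℝ}
    (hα : 0 < shellDensity n C r * (1 - shellDensity n C r)) :
    ∃ (J : ℂ →ₗᵢ[ℝ] EuclideanSpace ℝ (Fin n)) (ζ : Circle),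
      shellDensity n C r * (1 - shellDensity n C r) ≤
        P.real {ω | r • U ω (J 1) ∈ C ∧ r • U ω (J ζ) ∉ C} := by
  have hUx : ∀ x, Measurable fun ω => U ω x :=
    fun x => hU.comp (measurable_id.prodMk measurable_const)
  have hlaw := fun (s : ℝ) (e : EuclideanSpace ℝ (Fin n)) (he : ‖e‖ = 1) =>
    measureReal_random_isometry P U hU hinv hC s he
  set α := shellDensity n C r with hαdef
  obtain ⟨e, he⟩ : ∃ e : EuclideanSpace ℝ (Fin n), ‖e‖ = 1 := by
    rcases subsingleton_or_nontrivial (EuclideanSpace ℝ (Fin n)) with h | h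
    · exfalso
      rcases Set.eq_empty_or_nonempty C with h0 | ⟨x, hx⟩
      · rw [hαdef, h0, shellDensity] at hα
        simp at hα
      · have : C = Set.univ := Set.eq_univ_of_forall fun y => Subsingleton.elim x y ▸ hx
        rw [hαdef, this, shellDensity] at hα
        simp at hα
    · exact exists_norm_eq _ zero_le_one
  obtain ⟨w, hw1, hw⟩ : ∃ w : EuclideanSpace ℝ (Fin n), ‖w‖ = 1 ∧
      α * (1 - α) ≤ P.real {ω | r • U ω e ∈ C ∧ r • U ω w ∉ C} := by
    obtain ⟨ω', hω'⟩ := exists_le_measureReal_slice P P (A := {ω | r • U ω e ∈ C})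
      (((hUx e).const_smul r) hC) (S := {p | r • U p.1 (U p.2 e) ∉ C}) (c := 1 - α)
      (by
        have h1 : Measurable fun p : Ω × Ω => (p.1, U p.2 e) :=
          measurable_fst.prodMk ((hUx e).comp measurable_snd)
        exact (((hU.comp h1).const_smul r) hC).compl)
      (fun ω _ => by
        have h1 : {y | (ω, y) ∈ {p : Ω × Ω | r • U p.1 (U p.2 e) ∉ C}} =
            {y | r • U y e ∈ U ω ⁻¹' C}ᶜ := by
          ext y; simp
        have hm : MeasurableSet (U ω ⁻¹' C) := (U ω).continuous.measurable hC
        have hm' : MeasurableSet {y | r • U y e ∈ U ω ⁻¹' C} := ((hUx e).const_smul r) hm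
        rw [h1, probReal_compl_eq_one_sub hm',
          measureReal_random_isometry P U hU hinv hm r he, shellDensity_preimage_isometry n hC])
    rw [hlaw r e he] at hω'
    exact ⟨U ω' e, by rw [LinearIsometryEquiv.norm_map, he], hω'⟩
  have hwpos := hα.trans_le hw
  obtain ⟨J, ζ, hJ1, hJζ⟩ : ∃ (J : ℂ →ₗᵢ[ℝ] EuclideanSpace ℝ (Fin n)) (ζ : Circle),
      J 1 = e ∧ J ζ = w := exists_complex_isometry he hw1
    (fun h => by
      rw [h] at hwpos
      simp at hwpos)
    (fun h => by
      have : {ω | r • U ω e ∈ C ∧ r • U ω w ∉ C} = ∅ := by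
        ext x
        simp only [Set.mem_ofPred_eq, Set.mem_empty_iff_false, iff_false, not_and, not_not, h]
        intro hx
        rw [map_neg, smul_neg]
        exact hsymm _ hx
      rw [this] at hwpos
      simp at hwpos)
  exact ⟨J, ζ, by rwa [hJ1, hJζ]⟩

/-- Density increment computed from a right-invariant random isometry and an invariant probability
measure on the circle. -/
lemma shellDensity_increment_of_random_isometry {n : ℕ} {Ω : Type} [MeasurableSpace Ω]
    (P : Measure Ω) [IsProbabilityMeasure P]
    (U : Ω → (EuclideanSpace ℝ (Fin n) ≃ₗᵢ[ℝ] EuclideanSpace ℝ (Fin n)))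
    (hU : Measurable (Function.uncurry fun ω x => U ω x))
    (hinv : ∀ (T : EuclideanSpace ℝ (Fin n) ≃ₗᵢ[ℝ] EuclideanSpace ℝ (Fin n))
      (x y : EuclideanSpace ℝ (Fin n)),
      P.map (fun ω => (U ω (T x), U ω (T y))) = P.map (fun ω => (U ω x, U ω y)))
    [MeasurableSpace Circle] [BorelSpace Circle]
    (μ : Measure Circle) [IsProbabilityMeasure μ] [μ.IsMulLeftInvariant]
    {C : Set (EuclideanSpace ℝ (Fin n))}
    (hcl : IsClosed C) (hconv : Convex ℝ C) (hsymm : ∀ x ∈ C, -x ∈ C) {r κ : ℝ}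
    (hκ : 0 < κ) (hκ1 : κ < 1) (hα : 0 < shellDensity n C r * (1 - shellDensity n C r)) :
    shellDensity n C r + κ / 120 * (shellDensity n C r * (1 - shellDensity n C r)) ^ 2 ≤
      shellDensity n C (r * (1 - κ)) := by
  have hUx : ∀ x, Measurable fun ω => U ω x :=
    fun x => hU.comp (measurable_id.prodMk measurable_const)
  have hC : MeasurableSet C := hcl.measurableSet
  have hlaw := fun (s : ℝ) (e : EuclideanSpace ℝ (Fin n)) (he : ‖e‖ = 1) =>
    measureReal_random_isometry P U hU hinv hC s he
  obtain ⟨J, ζ, hw⟩ := exists_plane_escaping P U hU hinv hC hsymm hα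
  set α := shellDensity n C r with hαdef
  have hJU : ∀ f : Circle → ℂ, Continuous f →
      Measurable fun p : Ω × Circle => r • U p.1 (J (f p.2)) := by
    intro f hf
    have h1 : Measurable fun p : Ω × Circle => (p.1, J (f p.2)) :=
      measurable_fst.prodMk ((J.continuous.comp hf).measurable.comp measurable_snd)
    exact (hU.comp h1).const_smul r
  have hJnorm : ∀ z : Circle, ‖J z‖ = 1 := fun z => by rw [J.norm_map, Circle.norm_coe]
  let L : Ω → Set ℂ := fun ω => {z | r • U ω (J z) ∈ C}
  have hLmeas : ∀ s : ℝ, MeasurableSet {p : Ω × Circle | s • (p.2 : ℂ) ∈ L p.1} := fun s =>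
    hJU (fun z => s • (z : ℂ)) (by fun_prop) hC
  have hLint : ∀ s : ℝ, ∫ ω, μ.real {z : Circle | s • (z : ℂ) ∈ L ω} ∂P
      = shellDensity n C (r * s) := by
    intro s
    have h1 : ∀ z : Circle, P.real {ω | s • (z : ℂ) ∈ L ω} = shellDensity n C (r * s) := by
      intro z
      rw [← hlaw (r * s) (J z) (hJnorm z)]
      have h2 : ∀ ω, r • U ω (J (s • (z : ℂ))) = (r * s) • U ω (J z) := fun ω => by
        rw [map_smul, map_smul, smul_smul]
      change P.real {ω | r • U ω (J (s • (z : ℂ))) ∈ C} = _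
      simp_rw [h2]
    refine (integral_measureReal_slice_swap P μ (hLmeas s)).trans ?_
    simp only [Set.mem_ofPred_eq, h1]
    simp
  set A : Ω → Set Circle := fun ω => {z | (z : ℂ) ∈ L ω} with hA
  set B : Ω → Set Circle := fun ω => {z | (1 - κ) • (z : ℂ) ∈ L ω} with hB
  set Q : Ω → Set Circle := fun ω => {z | z ∈ A ω ∧ z * ζ ∉ A ω} with hQ
  have hLcl : ∀ ω, IsClosed (L ω) := fun ω =>
    hcl.preimage (((U ω).continuous.comp J.continuous).const_smul r)
  have hAmeas : ∀ ω, MeasurableSet (A ω) := fun ω =>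
    ((hLcl ω).preimage (f := fun z : Circle => (z : ℂ)) (by fun_prop)).measurableSet
  have hAint : ∫ ω, μ.real (A ω) ∂P = α := by
    have := hLint 1
    simpa [hA] using this
  have hAi : Integrable (fun ω => μ.real (A ω)) P := by
    have := integrable_measureReal_slice P μ (hLmeas 1)
    simpa [hA] using this
  have hBi : Integrable (fun ω => μ.real (B ω)) P := integrable_measureReal_slice P μ (hLmeas _)
  have hQmeas : MeasurableSet {p : Ω × Circle | p.2 ∈ Q p.1} :=
    (hJU (fun z => (z : ℂ)) (by fun_prop) hC).inter
      (hJU (fun z => ((z * ζ : Circle) : ℂ)) (by fun_prop) hC).compl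
  have hQi : Integrable (fun ω => μ.real (Q ω)) P := integrable_measureReal_slice P μ hQmeas
  have hQint : α * (1 - α) ≤ ∫ ω, μ.real (Q ω) ∂P := by
    have h1 : ∀ z : Circle, P.real {ω | z ∈ Q ω} = P.real {ω | r • U ω (J 1) ∈ C ∧ r • U ω (J ζ) ∉ C} := by
      intro z
      obtain ⟨T, hT⟩ := exists_isometry_extending_rotation J z
      have h := congrArg (fun m => m.real {p | r • p.1 ∈ C ∧ r • p.2 ∉ C}) (hinv T (J 1) (J ζ))
      have hm : MeasurableSet {p : EuclideanSpace ℝ (Fin n) × EuclideanSpace ℝ (Fin n) |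
          r • p.1 ∈ C ∧ r • p.2 ∉ C} :=
        ((measurable_fst.const_smul r) hC).inter ((measurable_snd.const_smul r) hC).compl
      rw [map_measureReal_apply ((hUx _).prodMk (hUx _)) hm,
        map_measureReal_apply ((hUx _).prodMk (hUx _)) hm] at h
      refine Eq.trans ?_ h
      rw [hT, hT]
      simp [hQ, hA, L]
    have h2 : ∫ ω, μ.real (Q ω) ∂P = ∫ z, P.real {ω | z ∈ Q ω} ∂μ :=
      integral_measureReal_slice_swap P μ hQmeas
    simp only [h1] at h2
    rw [h2]
    simpa using hw
  have hQle : ∀ ω, μ.real (Q ω) ≤ 2 * (μ.real (A ω) * (1 - μ.real (A ω))) := by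
    intro ω
    have h1 : μ.real (Q ω) ≤ μ.real (A ω) := measureReal_mono fun z hz => hz.1
    have h2 : μ.real (Q ω) ≤ 1 - μ.real (A ω) := by
      rw [← probReal_compl_eq_one_sub (hAmeas ω)]
      have : μ.real ((fun z => z * ζ) ⁻¹' (A ω)ᶜ) = μ.real (A ω)ᶜ := by
        rw [measureReal_def, measure_preimage_mul_right, measureReal_def]
      rw [← this]
      exact measureReal_mono fun z hz => hz.2
    have h3 : 0 ≤ μ.real (A ω) := measureReal_nonneg
    have h4 : μ.real (A ω) ≤ 1 := measureReal_le_one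
    rcases le_total (μ.real (A ω)) (1 / 2) with h | h <;> nlinarith
  set m := α * (1 - α) / 2 with hm
  have hpt : ∀ ω, μ.real (A ω) + κ / 30 * (m * μ.real (Q ω) - m ^ 2) ≤ μ.real (B ω) := by
    intro ω
    have h1 := circle_density_increment μ (hLcl ω)
      (hconv.linear_preimage (r • ((U ω).toLinearEquiv.toLinearMap ∘ₗ J.toLinearMap)))
      (fun z hz => by
        change r • U ω (J (-z)) ∈ C
        rw [map_neg, map_neg, smul_neg]
        exact hsymm _ hz) hκ hκ1
    refine le_trans ?_ h1
    have h2 := hQle ω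
    change _ ≤ μ.real (A ω) + κ / 30 * (μ.real (A ω) * (1 - μ.real (A ω))) ^ 2
    have h3 : m * μ.real (Q ω) - m ^ 2 ≤ (μ.real (A ω) * (1 - μ.real (A ω))) ^ 2 := by
      nlinarith [sq_nonneg (μ.real (A ω) * (1 - μ.real (A ω)) - m)]
    gcongr
  have hDi : Integrable (fun ω => m * μ.real (Q ω) - m ^ 2) P :=
    (hQi.const_mul m).sub (integrable_const _)
  have hEi : Integrable (fun ω => κ / 30 * (m * μ.real (Q ω) - m ^ 2)) P := hDi.const_mul _
  have hsplit : ∫ ω, (μ.real (A ω) + κ / 30 * (m * μ.real (Q ω) - m ^ 2)) ∂P =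
      α + κ / 30 * (m * ∫ ω, μ.real (Q ω) ∂P - m ^ 2) := by
    rw [integral_add hAi hEi, integral_const_mul, integral_sub (hQi.const_mul m)
      (integrable_const _), integral_const_mul, hAint]
    simp
  have hBint : ∫ ω, μ.real (B ω) ∂P = shellDensity n C (r * (1 - κ)) := hLint (1 - κ)
  have hfin : α + κ / 30 * (m * ∫ ω, μ.real (Q ω) ∂P - m ^ 2) ≤
      shellDensity n C (r * (1 - κ)) := by
    rw [← hsplit, ← hBint]
    exact integral_mono (hAi.add hEi) hBi hpt
  refine le_trans ?_ hfin
  have h1 : m * (2 * m) ≤ m * ∫ ω, μ.real (Q ω) ∂P := by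
    gcongr
    linarith
  have h2 : κ / 120 * (α * (1 - α)) ^ 2 = κ / 30 * (m * (2 * m) - m ^ 2) := by rw [hm]; ring
  rw [h2]
  gcongr

/-- Density increment for closed symmetric convex sets whose shell density is nondegenerate. -/
lemma shellDensity_increment_of_isClosed {n : ℕ} {C : Set (EuclideanSpace ℝ (Fin n))}
    (hcl : IsClosed C) (hconv : Convex ℝ C) (hsymm : ∀ x ∈ C, -x ∈ C) {r κ : ℝ}
    (hκ : 0 < κ) (hκ1 : κ < 1) (hα : 0 < shellDensity n C r * (1 - shellDensity n C r)) :
    shellDensity n C r + κ / 120 * (shellDensity n C r * (1 - shellDensity n C r)) ^ 2 ≤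
      shellDensity n C (r * (1 - κ)) := by
  obtain ⟨Ω, _, P, _, U, hUx, hinv⟩ := exists_random_isometry n
  have hU : Measurable (Function.uncurry fun ω x => U ω x) :=
    (measurable_uncurry_of_continuous_of_measurable (u := fun x ω => U ω x)
      (fun ω => (U ω).continuous) hUx).comp measurable_swap
  let _ : MeasurableSpace Circle := borel Circle
  have : BorelSpace Circle := ⟨rfl⟩
  let μ : Measure Circle := Measure.haarMeasure ⊤
  have : IsProbabilityMeasure μ := ⟨by
    have := Measure.haarMeasure_self (K₀ := (⊤ : TopologicalSpace.PositiveCompacts Circle))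
    simpa using this⟩
  exact shellDensity_increment_of_random_isometry P U hU hinv μ hcl hconv hsymm hκ hκ1 hα

/-- A symmetric convex set meeting some sphere in positive measure is a neighbourhood of `0`. -/
lemma zero_mem_interior_of_shellDensity_pos {n : ℕ} {K : Set (EuclideanSpace ℝ (Fin n))}
    (hconv : Convex ℝ K) (hsymm : ∀ x ∈ K, -x ∈ K) {r : ℝ} (hr : 0 < r)
    (hpos : 0 < shellDensity n K r) : (0 : EuclideanSpace ℝ (Fin n)) ∈ interior K := by
  have hne : K.Nonempty := by
    rw [Set.nonempty_iff_ne_empty]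
    rintro rfl
    simp [shellDensity] at hpos
  have hmid : ∀ x ∈ K, (0 : EuclideanSpace ℝ (Fin n)) ∈ openSegment ℝ x (-x) := fun x _ =>
    ⟨1 / 2, 1 / 2, by norm_num, by norm_num, by norm_num, by simp⟩
  obtain ⟨x₀, hx₀⟩ := hne
  have h0 : (0 : EuclideanSpace ℝ (Fin n)) ∈ K :=
    hconv.openSegment_subset hx₀ (hsymm _ hx₀) (hmid _ hx₀)
  have hne_int : (interior K).Nonempty := by
    rw [hconv.interior_nonempty_iff_affineSpan_eq_top]
    by_contra hspan
    set W := (affineSpan ℝ K).direction with hW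
    have hWtop : W ≠ ⊤ := fun h => hspan <|
      (AffineSubspace.direction_eq_top_iff_of_nonempty
        ⟨0, subset_affineSpan ℝ K h0⟩).mp h
    have hKW : K ⊆ W := fun x hx => by
      have := AffineSubspace.vsub_mem_direction (subset_affineSpan ℝ K hx)
        (subset_affineSpan ℝ K h0)
      simpa using this
    have hWm : MeasurableSet (W : Set (EuclideanSpace ℝ (Fin n))) :=
      W.closed_of_finiteDimensional.measurableSet
    have h1 := shellDensity_mono n hKW r
    rw [shellDensity_eq_stdGaussian n hWm] at h1
    have h2 : {x : EuclideanSpace ℝ (Fin n) | (r / ‖x‖) • x ∈ (W : Set _)} ⊆ W := by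
      intro x hx
      rcases eq_or_ne x 0 with rfl | hx0
      · exact W.zero_mem
      · exact (W.smul_mem_iff (div_ne_zero hr.ne' (norm_ne_zero_iff.mpr hx0))).mp hx
    have h3 := measure_mono_null h2 (stdGaussian_submodule n W hWtop)
    rw [measureReal_def, h3] at h1
    simp only [ENNReal.toReal_zero] at h1
    linarith
  obtain ⟨x, hx⟩ := hne_int
  have hxK := interior_subset hx
  exact hconv.openSegment_interior_closure_subset_interior hx (subset_closure (hsymm _ hxK))
    (hmid x hxK)

/-- Kruskal-Katona for centrally symmetric convex sets. -/
theorem kruskalKatona_centrally_symmetric :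
    ∃ c : ℝ, 0 < c ∧
      ∀ (n : ℕ) (K : Set (EuclideanSpace ℝ (Fin n))) (r κ : ℝ),
        Convex ℝ K → (∀ x, x ∈ K ↔ -x ∈ K) →
        0 < r → shellDensity n K r ∈ Set.Ioo (0 : ℝ) 1 →
        0 < κ → κ < 1 / 10 →
        shellDensity n K r
            + c * κ * (shellDensity n K r * (1 - shellDensity n K r)) ^ 2
          ≤ shellDensity n K (r * (1 - κ)) := by
  refine ⟨1 / 240, by norm_num, fun n K r κ hconv hsymm hr hα hκ hκ1 => ?_⟩
  have hsymm' : ∀ x ∈ K, -x ∈ K := fun x => (hsymm x).mp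
  have h0 := zero_mem_interior_of_shellDensity_pos hconv hsymm' hr hα.1
  set C := closure K with hC
  have hCconv : Convex ℝ C := hconv.closure
  have hCsymm : ∀ x ∈ C, -x ∈ C := fun x hx =>
    map_mem_closure continuous_neg hx fun y hy => hsymm' y hy
  have hC0 : (0 : EuclideanSpace ℝ (Fin n)) ∈ C := subset_closure (interior_subset h0)
  have hKC := shellDensity_mono n (subset_closure : K ⊆ C) r
  -- Shrinking moves `closure K` into `interior K`, so measurability of `K` is not needed.
  have hshrink : shellDensity n C (r * (1 - κ / 2)) ≤ shellDensity n K (r * (1 - κ)) := by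
    refine le_trans ?_ (shellDensity_mono n interior_subset _)
    rw [shellDensity_eq_stdGaussian n isClosed_closure.measurableSet,
      shellDensity_eq_stdGaussian n isOpen_interior.measurableSet]
    refine measureReal_mono fun x hx => ?_
    refine hconv.openSegment_interior_closure_subset_interior h0 hx
      ⟨1 - (1 - κ) / (1 - κ / 2), (1 - κ) / (1 - κ / 2), ?_, ?_, by ring, ?_⟩
    · rw [sub_pos, div_lt_one (by linarith)]; linarith
    · exact div_pos (by linarith) (by linarith)
    · rw [smul_zero, zero_add, smul_smul]
      congr 1
      rw [← mul_div_assoc, mul_left_comm, div_mul_cancel₀ _ (by linarith)]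
  refine le_trans ?_ hshrink
  set a := shellDensity n K r with ha
  set b := shellDensity n C r with hb
  have hb1 : b ≤ 1 := measureReal_le_one (μ := sphereUniform n r)
  have hab : a + 1 / 240 * κ * (a * (1 - a)) ^ 2 ≤ b + κ / 2 / 120 * (b * (1 - b)) ^ 2 := by
    have h1 : (a * (1 - a)) ^ 2 - (b * (1 - b)) ^ 2 ≤ b - a := by
      obtain ⟨ha0, ha1⟩ := hα
      have h2 : (a * (1 - a)) ^ 2 - (b * (1 - b)) ^ 2
          = (b - a) * ((a + b - 1) * (a * (1 - a) + b * (1 - b))) := by ring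
      have h3 : a * (1 - a) + b * (1 - b) ≤ 1 / 2 := by
        nlinarith [sq_nonneg (a - 1 / 2), sq_nonneg (b - 1 / 2)]
      have h4 : 0 ≤ a * (1 - a) + b * (1 - b) := by nlinarith
      have h5 : (a + b - 1) * (a * (1 - a) + b * (1 - b)) ≤ 1 := by nlinarith
      rw [h2]
      nlinarith
    nlinarith
  refine hab.trans ?_
  rcases hb1.lt_or_eq with hb1 | hb1
  · exact shellDensity_increment_of_isClosed isClosed_closure hCconv hCsymm (by linarith)
      (by linarith) (mul_pos (hα.1.trans_le hKC) (by linarith))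
  · have h : b + κ / 2 / 120 * (b * (1 - b)) ^ 2 = b := by rw [hb1]; ring
    rw [h, hb,
      shellDensity_eq_stdGaussian n isClosed_closure.measurableSet,
      shellDensity_eq_stdGaussian n isClosed_closure.measurableSet]
    refine measureReal_mono fun x hx => ?_
    have := hCconv.smul_mem_of_zero_mem hC0 hx (t := 1 - κ / 2) ⟨by linarith, by linarith⟩
    rw [smul_smul] at this
    change (r * (1 - κ / 2) / ‖x‖) • x ∈ C
    convert this using 2
    ring
end

section
/- If K ⊆ ℝⁿ is convex and contains the origin 0ⁿ, then the shell density function α_K : (0, ∞) → [0,1] is non-increasing: for all 0 < r ≤ r', α_K(r') ≤ α_K(r). -/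
open MeasureTheory ProbabilityTheory

instance isFiniteMeasure_sphereUniform (n : ℕ) (r : ℝ) :
    IsFiniteMeasure (sphereUniform n r) := by
  unfold sphereUniform _root_.stdGaussian
  infer_instance

theorem sphereUniform_mul (n : ℕ) (s r : ℝ) :
    sphereUniform n (s * r) = (sphereUniform n r).map (s • ·) := by
  unfold sphereUniform
  rw [Measure.map_map (by fun_prop) (by fun_prop)]
  congr 1
  ext1 x
  simp only [Function.comp_apply, smul_smul, mul_div_assoc]

/-- The identity holds for arbitrary sets (as outer measures), since dilation by `s ≠ 0` is a
measurable equivalence. -/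
theorem sphereUniform_mul_apply (n : ℕ) {s : ℝ} (hs : s ≠ 0) (r : ℝ)
    (K : Set (EuclideanSpace ℝ (Fin n))) :
    sphereUniform n (s * r) K = sphereUniform n r ((s • ·) ⁻¹' K) := by
  rw [sphereUniform_mul]
  exact (MeasurableEquiv.smul₀ s hs).map_apply K

/-- If `K ⊆ ℝⁿ` is convex and contains the origin, then the shell density function
`α_K` is non-increasing on `(0, ∞)`. -/
theorem shellDensity_antitone_of_convex :
    ∀ (n : ℕ) (K : Set (EuclideanSpace ℝ (Fin n))),
      Convex ℝ K → (0 : EuclideanSpace ℝ (Fin n)) ∈ K →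
      ∀ r r' : ℝ, 0 < r → r ≤ r' →
        shellDensity n K r' ≤ shellDensity n K r := by
  intro n K hK h0 r r' hr hrr'
  have hs : 1 ≤ r' / r := (one_le_div hr).2 hrr'
  have hr' : r' = r' / r * r := (div_mul_cancel₀ r' hr.ne').symm
  have hsub : ((r' / r) • ·) ⁻¹' K ⊆ K := fun x hx => by
    have := hK.smul_mem_of_zero_mem h0 hx ⟨inv_nonneg.2 (by linarith), inv_le_one_of_one_le₀ hs⟩
    rwa [inv_smul_smul₀ (by linarith)] at this
  unfold shellDensity
  refine ENNReal.toReal_mono (measure_ne_top _ _) ?_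
  rw [hr', sphereUniform_mul_apply n (by linarith)]
  exact measure_mono hsub
end

section
/- Let K ⊆ ℝⁿ be a centrally symmetric convex set, let V ⊆ ℝⁿ be a 2-dimensional linear subspace, and suppose μ_{V,1}(K ∩ V ∩ S^{n−1}) = p ∈ (0,1). Let 0 ≤ κ ≤ 1/10 and let B_{K,V} = {z ∈ K ∩ V : ‖z‖₂ = 1−κ and z/(1−κ) ∉ K}. Then μ_{V,1−κ}(B_{K,V}) ≥ (κ(1−p)/2) · sin(πp/2); equivalently, the total angular measure of B_{K,V} is at least (2πκ(1−p)/2) · sin(πp/2). -/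
open MeasureTheory ProbabilityTheory

/-- `μ_{V,r}(A)` for the 2-dimensional subspace `V = range φ`, where
`φ : ℝ² →ₗᵢ ℝⁿ` is a linear isometry: the fraction of the circle
`V ∩ {‖x‖ = r}` occupied by `A`, obtained by pushing forward the uniform
probability measure on the radius-`r` circle of `ℝ²` through `φ`. -/
noncomputable def circleFracVia (n : ℕ)
    (φ : EuclideanSpace ℝ (Fin 2) →ₗᵢ[ℝ] EuclideanSpace ℝ (Fin n)) (r : ℝ)
    (A : Set (EuclideanSpace ℝ (Fin n))) : ℝ :=
  (((sphereUniform 2 r).map φ) A).toReal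

open Set
open scoped ENNReal

/-- The point of the Euclidean plane with angle `θ` on the unit circle. -/
noncomputable def unitCirclePoint (θ : ℝ) : EuclideanSpace ℝ (Fin 2) :=
  !₂[Real.cos θ, Real.sin θ]

lemma continuous_unitCirclePoint : Continuous unitCirclePoint := by
  unfold unitCirclePoint
  fun_prop

lemma norm_unitCirclePoint (θ : ℝ) : ‖unitCirclePoint θ‖ = 1 := by
  simp [unitCirclePoint, EuclideanSpace.norm_eq]

lemma unitCirclePoint_add_pi (θ : ℝ) : unitCirclePoint (θ + Real.pi) = -unitCirclePoint θ := by
  ext i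
  fin_cases i <;> simp [unitCirclePoint]

lemma measurable_planePoint :
    Measurable (fun q : ℝ × ℝ => (!₂[q.1, q.2] : EuclideanSpace ℝ (Fin 2))) :=
  (by fun_prop : Continuous _).measurable

lemma stdGaussian_two_eq_map_withDensity :
    _root_.stdGaussian 2 = (volume.withDensity fun q : ℝ × ℝ =>
      gaussianPDF 0 1 q.1 * gaussianPDF 0 1 q.2).map
        (fun q : ℝ × ℝ => (!₂[q.1, q.2] : EuclideanSpace ℝ (Fin 2))) := by
  have h1 := (measurePreserving_piFinTwo (fun _ : Fin 2 => gaussianReal 0 1)).symm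
  rw [_root_.stdGaussian, ← h1.map_eq, Measure.map_map (by fun_prop) h1.measurable]
  rw [gaussianReal_of_var_ne_zero _ one_ne_zero,
    prod_withDensity (measurable_gaussianPDF 0 1) (measurable_gaussianPDF 0 1),
    ← Measure.volume_eq_prod]
  rfl

instance : IsProbabilityMeasure (_root_.stdGaussian 2) :=
  Measure.isProbabilityMeasure_map (by fun_prop)

lemma measurable_normalize (r : ℝ) :
    Measurable (fun x : EuclideanSpace ℝ (Fin 2) => (r / ‖x‖) • x) := by
  fun_prop

lemma exists_sphereUniform_two_eq_smul_map : ∃ c : ℝ≥0∞, sphereUniform 2 1 =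
    c • (volume.restrict (Ioo (-Real.pi) Real.pi)).map unitCirclePoint := by
  refine ⟨∫⁻ r in Ioi (0 : ℝ), ENNReal.ofReal r *
    ENNReal.ofReal ((√(2 * Real.pi))⁻¹ ^ 2 * Real.exp (-r ^ 2 / 2)), ?_⟩
  ext S hS
  have hm := continuous_unitCirclePoint.measurable
  rw [sphereUniform, Measure.map_apply (measurable_normalize 1) hS,
    stdGaussian_two_eq_map_withDensity,
    Measure.map_apply measurable_planePoint (measurable_normalize 1 hS),
    withDensity_apply _ (measurable_planePoint (measurable_normalize 1 hS)),
    ← lintegral_indicator (measurable_planePoint (measurable_normalize 1 hS)),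
    ← lintegral_comp_polarCoord_symm, Measure.smul_apply, Measure.map_apply hm hS, smul_eq_mul,
    ← lintegral_indicator_one (hm hS)]
  have : polarCoord.target = Ioi (0 : ℝ) ×ˢ Ioo (-Real.pi) Real.pi := rfl
  rw [this, Measure.volume_eq_prod, ← Measure.prod_restrict,
    ← lintegral_prod_mul (by fun_prop)
      ((measurable_one.indicator (hm hS)).aemeasurable), Measure.prod_restrict]
  refine setLIntegral_congr_fun (measurableSet_Ioi.prod measurableSet_Ioo) ?_
  rintro ⟨r, θ⟩ ⟨hr, -⟩
  have hr : 0 < r := hr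
  have hpt : (!₂[r * Real.cos θ, r * Real.sin θ] : EuclideanSpace ℝ (Fin 2)) =
      r • unitCirclePoint θ := by
    ext i
    fin_cases i <;> simp [unitCirclePoint]
  have hmem : (polarCoord.symm (r, θ) ∈ (fun q : ℝ × ℝ =>
      (!₂[q.1, q.2] : EuclideanSpace ℝ (Fin 2))) ⁻¹' ((fun x => (1 / ‖x‖) • x) ⁻¹' S)) ↔
      θ ∈ unitCirclePoint ⁻¹' S := by
    simp only [mem_preimage, polarCoord_symm_apply, hpt, norm_smul, norm_unitCirclePoint,
      smul_smul, Real.norm_eq_abs, abs_of_pos hr, mul_one]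
    rw [one_div_mul_cancel hr.ne', one_smul]
  beta_reduce
  by_cases h : θ ∈ unitCirclePoint ⁻¹' S
  · rw [indicator_of_mem (hmem.2 h), indicator_of_mem h]
    simp only [smul_eq_mul, polarCoord_symm_apply, gaussianPDF, gaussianPDFReal, Pi.one_apply,
      mul_one]
    rw [← ENNReal.ofReal_mul (by positivity)]
    congr 2
    simp only [NNReal.coe_one, mul_one, sub_zero]
    rw [mul_mul_mul_comm, ← Real.exp_add, sq (√(2 * Real.pi))⁻¹]
    congr 2
    linear_combination (-r ^ 2 / 2) * Real.sin_sq_add_cos_sq θ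
  · rw [indicator_of_notMem (mt hmem.1 h), indicator_of_notMem h]
    simp

lemma sphereUniform_two_eq_smul_map : sphereUniform 2 1 =
    ENNReal.ofReal (2 * Real.pi)⁻¹ •
      (volume.restrict (Ioo (-Real.pi) Real.pi)).map unitCirclePoint := by
  obtain ⟨c, hc⟩ := exists_sphereUniform_two_eq_smul_map
  have : IsProbabilityMeasure (sphereUniform 2 1) :=
    Measure.isProbabilityMeasure_map (measurable_normalize 1).aemeasurable
  have h1 : c * ENNReal.ofReal (2 * Real.pi) = 1 := by
    have := congrArg (fun μ : Measure _ => μ univ) hc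
    simp only [measure_univ, Measure.smul_apply, smul_eq_mul,
      Measure.map_apply continuous_unitCirclePoint.measurable MeasurableSet.univ, preimage_univ,
      Measure.restrict_apply_univ, Real.volume_Ioo] at this
    rw [this]
    ring_nf
  rw [hc, ENNReal.eq_inv_of_mul_eq_one_left h1, ENNReal.ofReal_inv_of_pos (by positivity)]

lemma sphereUniform_two_eq_map_smul (r : ℝ) :
    sphereUniform 2 r = (sphereUniform 2 1).map (fun x => r • x) := by
  rw [sphereUniform, sphereUniform, Measure.map_map (by fun_prop) (measurable_normalize 1)]
  congr 1
  ext1 x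
  simp [smul_smul, div_eq_mul_inv]

lemma sphereUniform_two_submodule_eq_zero {W : Submodule ℝ (EuclideanSpace ℝ (Fin 2))}
    (hW : W ≠ ⊤) : sphereUniform 2 1 W = 0 := by
  have hWm : MeasurableSet (W : Set (EuclideanSpace ℝ (Fin 2))) :=
    W.closed_of_finiteDimensional.measurableSet
  rw [sphereUniform, Measure.map_apply (measurable_normalize 1) hWm]
  have hpre : (fun x : EuclideanSpace ℝ (Fin 2) => (1 / ‖x‖) • x) ⁻¹' W = W := by
    ext x
    by_cases hx : x = 0
    · simp [hx]
    · exact W.smul_mem_iff (by positivity)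
  let g : (ℝ × ℝ) →ₗ[ℝ] EuclideanSpace ℝ (Fin 2) :=
    { toFun := fun q => !₂[q.1, q.2]
      map_add' := fun x y => by ext i; fin_cases i <;> simp
      map_smul' := fun x y => by ext i; fin_cases i <;> simp }
  rw [hpre, stdGaussian_two_eq_map_withDensity, Measure.map_apply measurable_planePoint hWm]
  refine withDensity_absolutelyContinuous _ _ (Measure.addHaar_submodule volume (W.comap g) ?_)
  intro h
  apply hW
  rw [eq_top_iff]
  intro x _
  have hx : (x 0, x 1) ∈ W.comap g := h ▸ Submodule.mem_top
  have hgx : g (x 0, x 1) = x := by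
    ext i
    fin_cases i <;> rfl
  rwa [Submodule.mem_comap, hgx] at hx

/-- A lower bound on the proportion of `G` in each gap of a closed set `T` gives the same lower
bound for the whole complement of `T`. -/
lemma mul_volume_compl_inter_Ioo_le {T G : Set ℝ} (hT : IsClosed T) (hG : MeasurableSet G)
    {a₀ b₀ : ℝ} (ha₀ : a₀ ∈ T) (hb₀ : b₀ ∈ T) (c : ℝ≥0∞)
    (hgap : ∀ a ∈ T, ∀ b ∈ T, a₀ ≤ a → a < b → b ≤ b₀ → Ioo a b ⊆ Tᶜ →
      c * ENNReal.ofReal (b - a) ≤ volume (G ∩ Ioo a b)) :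
    c * volume (Tᶜ ∩ Ioo a₀ b₀) ≤ volume (G ∩ Ioo a₀ b₀) := by
  set P : Set (ℝ × ℝ) :=
    {q | q.1 ∈ T ∧ q.2 ∈ T ∧ a₀ ≤ q.1 ∧ q.1 < q.2 ∧ q.2 ≤ b₀ ∧ Ioo q.1 q.2 ⊆ Tᶜ} with hP
  have hle : ∀ q ∈ P, ∀ q' ∈ P, q.1 < q'.1 → q.2 ≤ q'.1 := by
    rintro q hq q' hq' hlt
    by_contra! h
    exact hq.2.2.2.2.2 ⟨hlt, h⟩ hq'.1
  have hsnd : ∀ q ∈ P, ∀ q' ∈ P, q.1 = q'.1 → q = q' := by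
    rintro q hq q' hq' h
    refine Prod.ext h (le_antisymm ?_ ?_)
    · by_contra! h'
      exact hq.2.2.2.2.2 ⟨h ▸ hq'.2.2.2.1, h'⟩ hq'.2.1
    · by_contra! h'
      exact hq'.2.2.2.2.2 ⟨h ▸ hq.2.2.2.1, h'⟩ hq.2.1
  have hdisj : P.PairwiseDisjoint fun q => Ioo q.1 q.2 := by
    intro q hq q' hq' hne
    rw [Function.onFun, Set.disjoint_left]
    rintro x hx hx'
    rcases lt_trichotomy q.1 q'.1 with h | h | h
    · exact absurd (hle q hq q' hq' h) (not_le.2 (hx'.1.trans hx.2))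
    · exact hne (hsnd q hq q' hq' h)
    · exact absurd (hle q' hq' q hq h) (not_le.2 (hx.1.trans hx'.2))
  have hcount : P.Countable :=
    hdisj.countable_of_isOpen (fun _ _ => isOpen_Ioo) fun q hq => nonempty_Ioo.2 hq.2.2.2.1
  have hcover : Tᶜ ∩ Ioo a₀ b₀ ⊆ ⋃ q ∈ P, Ioo q.1 q.2 := by
    rintro x ⟨hxT, hx⟩
    have hA : IsCompact (T ∩ Icc a₀ x) := isCompact_Icc.inter_left hT
    have hB : IsCompact (T ∩ Icc x b₀) := isCompact_Icc.inter_left hT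
    obtain ⟨⟨ha1, ha2⟩, ha⟩ := hA.isGreatest_sSup ⟨a₀, ha₀, le_rfl, hx.1.le⟩
    obtain ⟨⟨hb1, hb2⟩, hb⟩ := hB.isLeast_sInf ⟨b₀, hb₀, hx.2.le, le_rfl⟩
    set a := sSup (T ∩ Icc a₀ x)
    set b := sInf (T ∩ Icc x b₀)
    have hax : a < x := lt_of_le_of_ne ha2.2 fun h => hxT (h ▸ ha1)
    have hxb : x < b := lt_of_le_of_ne hb2.1 fun h => hxT (h ▸ hb1)
    refine mem_biUnion (x := (a, b)) ⟨ha1, hb1, ha2.1, hax.trans hxb, hb2.2, ?_⟩ ⟨hax, hxb⟩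
    rintro y ⟨hy1, hy2⟩ hyT
    rcases le_total y x with h | h
    · exact absurd (ha ⟨hyT, ha2.1.trans hy1.le, h⟩) (not_le.2 hy1)
    · exact absurd (hb ⟨hyT, h, hy2.le.trans hb2.2⟩) (not_le.2 hy2)
  calc c * volume (Tᶜ ∩ Ioo a₀ b₀)
      ≤ c * ∑' q : P, volume (Ioo q.1.1 q.1.2) := by
        gcongr
        exact (measure_mono hcover).trans (measure_biUnion_le _ hcount _)
    _ = ∑' q : P, c * volume (Ioo q.1.1 q.1.2) := ENNReal.tsum_mul_left.symm
    _ ≤ ∑' q : P, volume (G ∩ Ioo q.1.1 q.1.2) := by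
        refine ENNReal.tsum_le_tsum fun q => ?_
        obtain ⟨q, h1, h2, h3, h4, h5, h6⟩ := q
        rw [Real.volume_Ioo]
        exact hgap _ h1 _ h2 h3 h4 h5 h6
    _ = volume (⋃ q ∈ P, G ∩ Ioo q.1 q.2) := by
        rw [measure_biUnion hcount (hdisj.mono fun q => inter_subset_right)
          fun q _ => hG.inter measurableSet_Ioo]
    _ ≤ volume (G ∩ Ioo a₀ b₀) := by
        refine measure_mono (iUnion₂_subset fun q hq => inter_subset_inter_right _ ?_)
        exact Ioo_subset_Ioo hq.2.2.1 hq.2.2.2.2.1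

lemma volume_inter_Ioo_eq_two_mul {A : Set ℝ} (hA : MeasurableSet A)
    (hper : ∀ θ, θ + Real.pi ∈ A ↔ θ ∈ A) (x : ℝ) :
    volume (A ∩ Ioo (-Real.pi) Real.pi) = 2 * volume (A ∩ Ioo x (x + Real.pi)) := by
  have hinv : ∀ g : AddSubgroup.zmultiples Real.pi, (fun y : ℝ => g +ᵥ y) ⁻¹' A = A := by
    have hp : Function.Periodic (fun θ => θ ∈ A) Real.pi := fun θ => propext (hper θ)
    intro g
    ext y
    exact iff_of_eq (hp.map_vadd_zmultiples g y)
  have key : ∀ t, volume (A ∩ Ioc t (t + Real.pi)) = volume (A ∩ Ioc x (x + Real.pi)) := fun t =>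
    (isAddFundamentalDomain_Ioc Real.pi_pos t).measure_set_eq
      (isAddFundamentalDomain_Ioc Real.pi_pos x) hA hinv
  have hIoc : ∀ s t : ℝ, volume (A ∩ Ioo s t) = volume (A ∩ Ioc s t) := fun s t =>
    measure_congr ((ae_eq_refl A).inter Ioo_ae_eq_Ioc)
  have h1 := key (-Real.pi)
  have h2 := key 0
  rw [neg_add_cancel] at h1
  rw [zero_add] at h2
  rw [hIoc, hIoc, ← Ioc_union_Ioc_eq_Ioc (neg_nonpos.2 Real.pi_pos.le) Real.pi_pos.le,
    inter_union_distrib_left, measure_union _ (hA.inter measurableSet_Ioc), h1, h2, two_mul]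
  exact (Ioc_disjoint_Ioc_of_le le_rfl).mono inter_subset_right inter_subset_right

lemma Convex.smul_mem_interior_of_mem_closure {E : Type*} [NormedAddCommGroup E]
    [NormedSpace ℝ E] {M : Set E} (hM : Convex ℝ M) (h0 : (0 : E) ∈ interior M) {x : E}
    (hx : x ∈ closure M) {t : ℝ} (ht0 : 0 ≤ t) (ht1 : t < 1) : t • x ∈ interior M := by
  simpa using hM.combo_interior_closure_mem_interior h0 hx (sub_pos.2 ht1) ht0 (by ring)

lemma neg_mem_closure_iff_of_neg_mem {E : Type*} [NormedAddCommGroup E] {M : Set E}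
    (hneg : ∀ x, x ∈ M ↔ -x ∈ M) (x : E) : -x ∈ closure M ↔ x ∈ closure M := by
  have hpre : Homeomorph.neg E ⁻¹' M = M := by
    ext y
    exact (hneg y).symm
  have h := (Homeomorph.neg E).preimage_closure M
  rw [hpre] at h
  exact Set.ext_iff.1 h x

lemma neg_mem_interior_iff_of_neg_mem {E : Type*} [NormedAddCommGroup E] {M : Set E}
    (hneg : ∀ x, x ∈ M ↔ -x ∈ M) (x : E) : -x ∈ interior M ↔ x ∈ interior M := by
  have hpre : Homeomorph.neg E ⁻¹' M = M := by
    ext y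
    exact (hneg y).symm
  have h := (Homeomorph.neg E).preimage_interior M
  rw [hpre] at h
  exact Set.ext_iff.1 h x

lemma Convex.zero_mem_interior_of_neg_mem {E : Type*} [NormedAddCommGroup E]
    [NormedSpace ℝ E] {M : Set E} (hM : Convex ℝ M) (hneg : ∀ x, x ∈ M ↔ -x ∈ M)
    (hne : (interior M).Nonempty) : (0 : E) ∈ interior M := by
  obtain ⟨x, hx⟩ := hne
  have hx' := (neg_mem_interior_iff_of_neg_mem hneg x).2 hx
  simpa using hM.interior hx hx' (a := 1 / 2) (b := 1 / 2) (by norm_num) (by norm_num)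
    (by norm_num)

/-- Points of a circular sector lying strictly below the chord of a convex set are interior. -/
lemma smul_unitCirclePoint_mem_interior {M : Set (EuclideanSpace ℝ (Fin 2))}
    (hM : Convex ℝ M) (h0 : 0 ∈ interior M) {m h d s : ℝ} (hh : h < Real.pi / 2) (hd : |d| < h)
    (ha : unitCirclePoint (m - h) ∈ closure M) (hb : unitCirclePoint (m + h) ∈ closure M)
    (hs : 0 ≤ s) (hlt : s * Real.cos d < Real.cos h) :
    s • unitCirclePoint (m + d) ∈ interior M := by
  obtain ⟨hd1, hd2⟩ := abs_lt.1 hd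
  have hpi := Real.pi_pos
  have hcd : 0 < Real.cos d := Real.cos_pos_of_mem_Ioo ⟨by linarith, by linarith⟩
  have hch : 0 < Real.cos h := Real.cos_pos_of_mem_Ioo ⟨by linarith, hh⟩
  have hsh : 0 < Real.sin h := Real.sin_pos_of_pos_of_lt_pi (by linarith) (by linarith)
  have hw1 : 0 < Real.sin (h - d) := Real.sin_pos_of_pos_of_lt_pi (by linarith) (by linarith)
  have hw2 : 0 < Real.sin (h + d) := Real.sin_pos_of_pos_of_lt_pi (by linarith) (by linarith)
  have hy := hM.closure ha hb (a := Real.sin (h - d) / (2 * Real.sin h * Real.cos d))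
    (b := Real.sin (h + d) / (2 * Real.sin h * Real.cos d)) (by positivity) (by positivity) (by
      rw [← add_div, div_eq_one_iff_eq (by positivity), Real.sin_sub, Real.sin_add]
      ring)
  have := hM.smul_mem_interior_of_mem_closure h0 hy (t := s * Real.cos d / Real.cos h)
    (by positivity) ((div_lt_one hch).2 hlt)
  convert this using 1
  ext i
  fin_cases i
  · simp only [unitCirclePoint, PiLp.smul_apply, PiLp.add_apply, smul_eq_mul, Fin.zero_eta,
      Matrix.cons_val_zero, Real.cos_add, Real.cos_sub, Real.sin_add, Real.sin_sub]
    field_simp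
    ring
  · simp only [unitCirclePoint, PiLp.smul_apply, PiLp.add_apply, smul_eq_mul, Fin.mk_one,
      Matrix.cons_val_one, Matrix.cons_val_fin_one,
      Real.cos_add, Real.cos_sub, Real.sin_add, Real.sin_sub]
    field_simp
    ring

lemma ofReal_mul_le_volume_inter_Ioo {M : Set (EuclideanSpace ℝ (Fin 2))}
    (hM : Convex ℝ M) (h0 : 0 ∈ interior M) {a b κ s : ℝ} (hab : a < b) (hpi : b - a < Real.pi)
    (ha : unitCirclePoint a ∈ closure M) (hb : unitCirclePoint b ∈ closure M)
    (hκ : 0 < κ) (hκ1 : κ ≤ 1) (hs : 0 < s) (hs1 : s ≤ Real.cos ((b - a) / 2)) :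
    ENNReal.ofReal (κ * s / 2) * ENNReal.ofReal (b - a) ≤
      volume ({θ | (1 - κ) • unitCirclePoint θ ∈ interior M} ∩ Ioo a b) := by
  set h := (b - a) / 2 with hh
  set t := κ * s / 2 * h with ht
  have hhpos : 0 < h := by rw [hh]; linarith
  have hcos1 : Real.cos h ≤ 1 := Real.cos_le_one h
  have htpos : 0 < t := by positivity
  have hth : t ≤ h := by
    have : κ * s ≤ 1 := mul_le_one₀ hκ1 hs.le (hs1.trans hcos1)
    nlinarith
  have key : ∀ d, |d| < h → h - t < |d| → (1 - κ) * Real.cos d < Real.cos h := by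
    intro d hd1 hd2
    have hlip := Real.lipschitzWith_cos.dist_le_mul |d| h
    rw [Real.dist_eq, Real.dist_eq, Real.cos_abs, NNReal.coe_one, one_mul,
      abs_sub_comm |d| h, abs_of_pos (sub_pos.2 hd1)] at hlip
    have h1 : Real.cos d < Real.cos h + t := by linarith [(abs_le.1 hlip).2]
    have h2 : t ≤ κ * Real.cos h * (h / 2) := by
      have : κ * s * (h / 2) ≤ κ * Real.cos h * (h / 2) := by gcongr
      linarith
    have h3 : h / 2 ≤ 1 := by linarith [Real.pi_le_four]
    have hch : 0 < Real.cos h := hs.trans_le hs1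
    have h4 : t ≤ κ * Real.cos h := h2.trans (mul_le_of_le_one_right (by positivity) h3)
    rcases hκ1.eq_or_lt with rfl | hlt
    · simpa using hch
    · calc (1 - κ) * Real.cos d < (1 - κ) * (Real.cos h + t) :=
            mul_lt_mul_of_pos_left h1 (by linarith)
        _ ≤ (1 - κ) * (Real.cos h + κ * Real.cos h) :=
            mul_le_mul_of_nonneg_left (by linarith) (by linarith)
        _ ≤ Real.cos h := by nlinarith [mul_pos (mul_pos hκ hκ) hch]
  have hmem : ∀ θ ∈ Ioo a b, h - t < |θ - (a + b) / 2| →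
      (1 - κ) • unitCirclePoint θ ∈ interior M := by
    rintro θ ⟨h1, h2⟩ h3
    have hd : |θ - (a + b) / 2| < h := abs_lt.2 ⟨by rw [hh]; linarith, by rw [hh]; linarith⟩
    have := smul_unitCirclePoint_mem_interior hM h0 (m := (a + b) / 2) (h := h)
      (d := θ - (a + b) / 2) (by rw [hh]; linarith) hd (by convert ha using 2; rw [hh]; ring)
      (by convert hb using 2; rw [hh]; ring) (sub_nonneg.2 hκ1) (key _ hd h3)
    rwa [add_sub_cancel] at this
  have hdisj : Disjoint (Ioo a (a + t)) (Ioo (b - t) b) := by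
    rw [Set.disjoint_left]
    rintro x hx hx'
    have := hx.2.trans_le (show a + t ≤ b - t by linarith)
    exact absurd hx'.1 (not_lt.2 this.le)
  calc ENNReal.ofReal (κ * s / 2) * ENNReal.ofReal (b - a)
      = volume (Ioo a (a + t) ∪ Ioo (b - t) b) := by
        rw [measure_union hdisj measurableSet_Ioo, Real.volume_Ioo, Real.volume_Ioo,
          ← ENNReal.ofReal_add (by linarith) (by linarith), ← ENNReal.ofReal_mul (by positivity)]
        congr 1
        rw [ht, hh]
        ring
    _ ≤ _ := by
        refine measure_mono (union_subset ?_ ?_)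
        · rintro θ ⟨h1, h2⟩
          have hθ : θ ∈ Ioo a b := ⟨h1, by linarith⟩
          refine ⟨hmem θ hθ (lt_abs.2 (Or.inr ?_)), hθ⟩
          linarith
        · rintro θ ⟨h1, h2⟩
          have hθ : θ ∈ Ioo a b := ⟨by linarith, h2⟩
          refine ⟨hmem θ hθ (lt_abs.2 (Or.inl ?_)), hθ⟩
          linarith

lemma mul_le_sphereUniform_two {M : Set (EuclideanSpace ℝ (Fin 2))}
    (hM : Convex ℝ M) (hneg : ∀ x, x ∈ M ↔ -x ∈ M) {p κ : ℝ}
    (hp : (sphereUniform 2 1 (M ∩ Metric.sphere 0 1)).toReal = p) (hp0 : 0 < p) (hp1 : p < 1)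
    (hκ : 0 < κ) (hκ1 : κ ≤ 1) :
    κ * (1 - p) / 2 * Real.sin (Real.pi * p / 2) ≤
      (sphereUniform 2 1 {x | ‖x‖ = 1 ∧ (1 - κ) • x ∈ M ∧ x ∉ M}).toReal := by
  have hpi := Real.pi_pos
  have hprob : IsProbabilityMeasure (sphereUniform 2 1) :=
    Measure.isProbabilityMeasure_map (measurable_normalize 1).aemeasurable
  have hA0 : sphereUniform 2 1 (M ∩ Metric.sphere 0 1) ≠ 0 := by
    intro h
    simp [h] at hp
    exact hp0.ne hp
  have h0M : (0 : EuclideanSpace ℝ (Fin 2)) ∈ M := by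
    obtain ⟨x, hx, -⟩ := nonempty_of_measure_ne_zero hA0
    simpa using hM hx ((hneg x).1 hx) (a := 1 / 2) (b := 1 / 2) (by norm_num) (by norm_num)
      (by norm_num)
  have h0 : (0 : EuclideanSpace ℝ (Fin 2)) ∈ interior M := by
    refine hM.zero_mem_interior_of_neg_mem hneg ?_
    rw [hM.interior_nonempty_iff_affineSpan_eq_top]
    by_contra hne
    have hspan : Submodule.span ℝ M ≠ ⊤ := by
      intro h
      apply hne
      apply AffineSubspace.ext_of_direction_eq
      · rw [AffineSubspace.direction_top, direction_affineSpan,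
          vectorSpan_eq_span_vsub_set_right ℝ h0M]
        simpa using h
      · exact ⟨0, subset_affineSpan ℝ M h0M, trivial⟩
    exact hA0 (measure_mono_null (inter_subset_left.trans Submodule.subset_span)
      (sphereUniform_two_submodule_eq_zero hspan))
  set L := closure M ∩ Metric.sphere (0 : EuclideanSpace ℝ (Fin 2)) 1 with hL
  set D := {x : EuclideanSpace ℝ (Fin 2) | ‖x‖ = 1 ∧ (1 - κ) • x ∈ M ∧ x ∉ M} with hD
  set T := unitCirclePoint ⁻¹' closure M with hT
  set G := {θ | (1 - κ) • unitCirclePoint θ ∈ interior M} ∩ Tᶜ with hG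
  set s := Real.sin (Real.pi * p / 2) with hs
  have hspos : 0 < s := Real.sin_pos_of_pos_of_lt_pi (by positivity) (by nlinarith)
  have hs1 : s ≤ 1 := Real.sin_le_one _
  have hcont := continuous_unitCirclePoint
  have hTcl : IsClosed T := isClosed_closure.preimage hcont
  have hGm : MeasurableSet G :=
    ((isOpen_interior.preimage (hcont.const_smul (1 - κ))).inter hTcl.isOpen_compl).measurableSet
  have hclneg := neg_mem_closure_iff_of_neg_mem hneg
  have hintneg := neg_mem_interior_iff_of_neg_mem hneg
  have hTper : ∀ θ, θ + Real.pi ∈ T ↔ θ ∈ T := fun θ => by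
    simp only [hT, mem_preimage, unitCirclePoint_add_pi, hclneg]
  have hGper : ∀ θ, θ + Real.pi ∈ G ↔ θ ∈ G := fun θ => by
    simp only [hG, mem_inter_iff, mem_compl_iff, hTper, mem_ofPred_eq, unitCirclePoint_add_pi,
      smul_neg, hintneg]
  have hLm : MeasurableSet L := (isClosed_closure.inter Metric.isClosed_sphere).measurableSet
  have hpreL : unitCirclePoint ⁻¹' L = T := by
    ext θ
    simp [hL, hT, norm_unitCirclePoint]
  have hνL : sphereUniform 2 1 L =
      ENNReal.ofReal (2 * Real.pi)⁻¹ * volume (T ∩ Ioo (-Real.pi) Real.pi) := by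
    rw [sphereUniform_two_eq_smul_map, Measure.smul_apply, Measure.map_apply hcont.measurable hLm,
      hpreL, Measure.restrict_apply hTcl.measurableSet, smul_eq_mul]
  have hAL : M ∩ Metric.sphere 0 1 ⊆ L := inter_subset_inter_left _ subset_closure
  obtain ⟨x₀, hx₀⟩ : T.Nonempty := by
    rw [nonempty_iff_ne_empty]
    intro h
    rw [h] at hνL
    exact hA0 (measure_mono_null hAL (by simpa using hνL))
  set v := (volume (Tᶜ ∩ Ioo x₀ (x₀ + Real.pi))).toReal with hv
  have hvfin : volume (Tᶜ ∩ Ioo x₀ (x₀ + Real.pi)) = ENNReal.ofReal v :=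
    (ENNReal.ofReal_toReal (measure_ne_top_of_subset inter_subset_right
      measure_Ioo_lt_top.ne)).symm
  have hv0 : 0 ≤ v := ENNReal.toReal_nonneg
  have hνLv : (sphereUniform 2 1 L).toReal = 1 - v / Real.pi := by
    have h1 : volume (T ∩ Ioo (-Real.pi) Real.pi) + 2 * ENNReal.ofReal v =
        ENNReal.ofReal (2 * Real.pi) := by
      rw [← hvfin, ← volume_inter_Ioo_eq_two_mul hTcl.measurableSet.compl
        (fun θ => not_congr (hTper θ)), inter_comm, inter_comm Tᶜ, ← Set.sdiff_eq,
        measure_inter_add_sdiff _ hTcl.measurableSet, Real.volume_Ioo]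
      ring_nf
    have h2 := congrArg ENNReal.toReal h1
    rw [ENNReal.toReal_add (measure_ne_top_of_subset inter_subset_right
      measure_Ioo_lt_top.ne) (by finiteness), ENNReal.toReal_mul, ENNReal.toReal_ofReal hv0,
      ENNReal.toReal_ofReal (by positivity), ENNReal.toReal_ofNat] at h2
    rw [hνL, ENNReal.toReal_mul, ENNReal.toReal_ofReal (by positivity), eq_sub_of_add_eq h2]
    field_simp
  have hvp : v / Real.pi ≤ 1 - p := by
    have := ENNReal.toReal_mono (measure_ne_top _ _) (measure_mono hAL (μ := sphereUniform 2 1))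
    linarith
  have hgap : ENNReal.ofReal (κ * s / 2) * ENNReal.ofReal v ≤
      volume (G ∩ Ioo x₀ (x₀ + Real.pi)) := by
    rw [← hvfin]
    refine mul_volume_compl_inter_Ioo_le hTcl hGm hx₀ ((hTper x₀).2 hx₀) _ ?_
    intro a ha b hb hxa hab hbx hsub
    have hbav : b - a ≤ v := by
      rw [← ENNReal.ofReal_le_ofReal_iff hv0, ← hvfin, ← Real.volume_Ioo]
      exact measure_mono (subset_inter hsub (Ioo_subset_Ioo hxa hbx))
    have hba : b - a ≤ Real.pi * (1 - p) := hbav.trans (by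
      rw [div_le_iff₀ hpi] at hvp
      linarith)
    have hba' : b - a < Real.pi := by nlinarith
    refine (ofReal_mul_le_volume_inter_Ioo hM h0 hab hba' ha hb hκ hκ1 hspos ?_).trans
      (measure_mono fun θ hθ => ⟨⟨hθ.1, hsub hθ.2⟩, hθ.2⟩)
    rw [hs, ← Real.cos_pi_div_two_sub]
    exact Real.cos_le_cos_of_nonneg_of_le_pi (by linarith) (by nlinarith) (by linarith)
  have hsplit := measure_inter_add_sdiff (μ := sphereUniform 2 1) D hLm
  have hDL : (sphereUniform 2 1 L).toReal ≤ (sphereUniform 2 1 (D ∩ L)).toReal + p := by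
    rw [← hp, ← ENNReal.toReal_add (measure_ne_top _ _) (measure_ne_top _ _)]
    refine ENNReal.toReal_mono (by finiteness) ((measure_mono ?_).trans (measure_union_le _ _))
    rintro x ⟨hx, hx1⟩
    by_cases hxM : x ∈ M
    · exact Or.inr ⟨hxM, hx1⟩
    · refine Or.inl ⟨⟨mem_sphere_zero_iff_norm.1 hx1, interior_subset ?_, hxM⟩, hx, hx1⟩
      exact hM.smul_mem_interior_of_mem_closure h0 hx (sub_nonneg.2 hκ1) (by linarith)
  have hDG : κ * s / 2 * v / Real.pi ≤ (sphereUniform 2 1 (D \ L)).toReal := by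
    rw [← ENNReal.ofReal_le_iff_le_toReal (measure_ne_top _ _)]
    calc ENNReal.ofReal (κ * s / 2 * v / Real.pi)
        = ENNReal.ofReal (2 * Real.pi)⁻¹ *
            (2 * (ENNReal.ofReal (κ * s / 2) * ENNReal.ofReal v)) := by
          rw [← ENNReal.ofReal_mul (by positivity), ← ENNReal.ofReal_ofNat 2,
            ← ENNReal.ofReal_mul (by positivity), ← ENNReal.ofReal_mul (by positivity)]
          congr 1
          field_simp
      _ ≤ ENNReal.ofReal (2 * Real.pi)⁻¹ * volume (G ∩ Ioo (-Real.pi) Real.pi) := by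
          rw [volume_inter_Ioo_eq_two_mul hGm hGper x₀]
          gcongr
      _ ≤ sphereUniform 2 1 (D \ L) := by
          rw [sphereUniform_two_eq_smul_map, Measure.smul_apply, smul_eq_mul]
          gcongr
          rw [← Measure.restrict_apply hGm]
          refine (measure_mono ?_).trans (Measure.le_map_apply hcont.aemeasurable _)
          rintro θ ⟨h1, h2⟩
          exact ⟨⟨norm_unitCirclePoint θ, interior_subset h1, fun h => h2 (subset_closure h)⟩,
            fun h => h2 h.1⟩
  rw [← hsplit, ENNReal.toReal_add (measure_ne_top _ _) (measure_ne_top _ _)]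
  have hc : κ * s / 2 ≤ 1 := by nlinarith
  have : κ * s / 2 * v / Real.pi = κ * s / 2 * (v / Real.pi) := by ring
  nlinarith [mul_nonneg (sub_nonneg.2 hc) (sub_nonneg.2 hvp)]

/-- Two-dimensional density increment for centrally symmetric convex sets
(Claim 2.6 of the paper).  Here `V = range φ` is a 2-dimensional subspace of `ℝⁿ`. -/
theorem two_d_increment_symmetric :
    ∀ (n : ℕ) (K : Set (EuclideanSpace ℝ (Fin n)))
      (φ : EuclideanSpace ℝ (Fin 2) →ₗᵢ[ℝ] EuclideanSpace ℝ (Fin n)) (p κ : ℝ),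
      Convex ℝ K → (∀ x, x ∈ K ↔ -x ∈ K) →
      circleFracVia n φ 1
          (K ∩ (LinearMap.range φ.toLinearMap : Set (EuclideanSpace ℝ (Fin n)))
             ∩ Metric.sphere (0 : EuclideanSpace ℝ (Fin n)) 1) = p →
      p ∈ Set.Ioo (0 : ℝ) 1 →
      0 ≤ κ → κ ≤ 1 / 10 →
      κ * (1 - p) / 2 * Real.sin (Real.pi * p / 2) ≤
        circleFracVia n φ (1 - κ)
          {z | z ∈ K ∧ z ∈ (LinearMap.range φ.toLinearMap : Set (EuclideanSpace ℝ (Fin n)))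
               ∧ ‖z‖ = 1 - κ ∧ (1 - κ)⁻¹ • z ∉ K} := by
  intro n K φ p κ hK hneg hp hpI hκ0 hκ1
  rcases hκ0.eq_or_lt with rfl | hκ
  · rw [zero_mul, zero_div, zero_mul]
    exact ENNReal.toReal_nonneg
  have hφ : MeasurableEmbedding φ := φ.isometry.isClosedEmbedding.measurableEmbedding
  have hpos : 0 < 1 - κ := by linarith
  have hMneg : ∀ x, x ∈ φ ⁻¹' K ↔ -x ∈ φ ⁻¹' K := fun x => by
    rw [mem_preimage, mem_preimage, map_neg]
    exact hneg _
  have hpM : (sphereUniform 2 1 (φ ⁻¹' K ∩ Metric.sphere 0 1)).toReal = p := by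
    rw [← hp, circleFracVia, hφ.map_apply]
    congr 2
    ext x
    simp
  refine (mul_le_sphereUniform_two (hK.linear_preimage φ.toLinearMap) hMneg hpM hpI.1 hpI.2 hκ
    (by linarith)).trans ?_
  have : IsProbabilityMeasure (sphereUniform 2 (1 - κ)) :=
    Measure.isProbabilityMeasure_map (measurable_normalize _).aemeasurable
  rw [circleFracVia, hφ.map_apply]
  refine ENNReal.toReal_mono (measure_ne_top _ _) ?_
  rw [sphereUniform_two_eq_map_smul (1 - κ)]
  refine (measure_mono ?_).trans (Measure.le_map_apply (by fun_prop) _)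
  rintro x ⟨hx1, hx2, hx3⟩
  refine ⟨hx2, ⟨_, rfl⟩, ?_, ?_⟩
  · rw [φ.norm_map, norm_smul, hx1, Real.norm_of_nonneg hpos.le, mul_one]
  · rw [← map_smul, smul_smul, inv_mul_cancel₀ hpos.ne', one_smul]
    exact hx3
end
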